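/- Let n ≥ 2 be an integer, let γ > n be real, 1 < p < n, and 1 < q ≤ p(n-1)/(n-p). Then there exists a constant C > 0 such that for every continuously differentiable function u : ℝ^n → ℝ one has (∫_{∂Ω_γ} |u(x)|^q w_γ(x) dH^{n-1}(x))^{1/q} ≤ C · ( (∫_{Ω_γ} |∇u(x)|^p dx)^{1/p} + (∫_{Ω_γ} |u(x)|^p dx)^{1/p} ), where w_γ(x) = x_n^β with β = (γ-n)(1+p(n-2))/((n-p)(n-1)). (This is the boundedness part of the weighted trace embedding W^{1,p}(Ω_γ) → L^q(∂Ω_γ, w_γ), stated on the dense class of C¹ functions.) -/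

import Mathlib

open MeasureTheory ENNReal

noncomputable section

/-- The outward `γ`-cuspidal domain
`Ω_γ = {x ∈ ℝⁿ : 0 < x_n < 1, 0 < x_i < x_n^α for i = 1,…,n-1}`, `α = (γ-1)/(n-1)`. -/
def cuspDomain (n : ℕ) (hn : 2 ≤ n) (γ : ℝ) : Set (EuclideanSpace ℝ (Fin n)) :=
  {x | 0 < x ⟨n - 1, by omega⟩ ∧ x ⟨n - 1, by omega⟩ < 1 ∧
    ∀ i : Fin n, (i : ℕ) < n - 1 →
      0 < x i ∧ x i < x ⟨n - 1, by omega⟩ ^ ((γ - 1) / ((n : ℝ) - 1))}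

lemma aux_add_rpow {x y p : ℝ} (hx : 0 ≤ x) (hy : 0 ≤ y) (hp : 0 ≤ p) :
    (x + y) ^ p ≤ 2 ^ p * (x ^ p + y ^ p) := by
  have h1 : x + y ≤ 2 * max x y := by
    have := le_max_left x y; have := le_max_right x y; linarith
  calc (x + y) ^ p ≤ (2 * max x y) ^ p := Real.rpow_le_rpow (by positivity) h1 hp
    _ = 2 ^ p * (max x y) ^ p := Real.mul_rpow (by norm_num) (le_max_of_le_left hx)
    _ ≤ _ := by
      gcongr
      rcases max_choice x y with h | h <;> rw [h]
      · have := Real.rpow_nonneg hy p; linarith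
      · have := Real.rpow_nonneg hx p; linarith

lemma aux_absorb {I A : ℝ≥0∞} {θ : ℝ} (h : I ≤ A * I ^ θ) (hI : I ≠ ⊤)
    (h1 : θ < 1) : I ≤ A ^ (1 / (1 - θ)) := by
  by_cases h0' : I = 0
  · simp [h0']
  have h2 : I ^ (1 - θ) ≤ A := by
    rw [ENNReal.rpow_sub _ _ h0' hI, ENNReal.rpow_one]
    exact ENNReal.div_le_of_le_mul h
  calc I = (I ^ (1 - θ)) ^ (1 / (1 - θ)) := by
        rw [← ENNReal.rpow_mul, mul_one_div_cancel (by linarith), ENNReal.rpow_one]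
    _ ≤ _ := ENNReal.rpow_le_rpow h2 (by rw [one_div]; exact inv_nonneg.2 (by linarith))

lemma aux_ftc {g : ℝ → ℝ} (hg : ContDiff ℝ 1 g) {A B x y : ℝ} (hx : x ∈ Set.Icc A B)
    (hy : y ∈ Set.Icc A B) :
    ENNReal.ofReal (g x) ≤ ENNReal.ofReal (g y) +
      ∫⁻ s in Set.Ioo A B, ENNReal.ofReal |deriv g s| := by
  have hc : Continuous (deriv g) := hg.continuous_deriv le_rfl
  have hd : Differentiable ℝ g := hg.differentiable one_ne_zero
  have hAB : A ≤ B := hx.1.trans hx.2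
  have h1 : ∫ s in y..x, deriv g s = g x - g y :=
    intervalIntegral.integral_deriv_eq_sub (fun s _ => hd s) (hc.intervalIntegrable _ _)
  have h2 : |∫ s in y..x, deriv g s| ≤ ∫ s in A..B, |deriv g s| := by
    calc _ ≤ |(∫ s in y..x, |deriv g s|)| := by
          simpa only [Real.norm_eq_abs] using intervalIntegral.norm_integral_le_abs_integral_norm (f := deriv g) (a := y) (b := x) (μ := volume)
      _ ≤ |(∫ s in A..B, |deriv g s|)| := by
        apply intervalIntegral.abs_integral_mono_interval
        · rw [Set.uIoc, Set.uIoc]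
          apply Set.Ioc_subset_Ioc
          · simp [hAB, hx.1, hy.1]
          · simp [hAB, hx.2, hy.2]
        · exact Filter.Eventually.of_forall fun s => abs_nonneg _
        · exact (hc.abs).intervalIntegrable _ _
      _ = _ := abs_of_nonneg (intervalIntegral.integral_nonneg hAB fun s _ => abs_nonneg _)
  have h3 : ENNReal.ofReal (∫ s in A..B, |deriv g s|) =
      ∫⁻ s in Set.Ioo A B, ENNReal.ofReal |deriv g s| := by
    rw [intervalIntegral.integral_of_le hAB, integral_Ioc_eq_integral_Ioo,
      ofReal_integral_eq_lintegral_ofReal]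
    · exact (hc.abs.integrableOn_Icc).mono_set Set.Ioo_subset_Icc_self
    · exact Filter.Eventually.of_forall fun s => abs_nonneg _
  rw [← h3]
  calc ENNReal.ofReal (g x) ≤ ENNReal.ofReal (g y + ∫ s in A..B, |deriv g s|) := by
        apply ENNReal.ofReal_le_ofReal
        have := le_abs_self (∫ s in y..x, deriv g s)
        linarith
    _ ≤ _ := ENNReal.ofReal_add_le

lemma aux_deriv_pow {φ : ℝ → ℝ} (hφ : ContDiff ℝ 1 φ) {q : ℝ} (hq : 1 < q) (s : ℝ) :
    HasDerivAt (fun s => |φ s| ^ q) (deriv (fun s => |φ s| ^ q) s) s ∧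
    |deriv (fun s => |φ s| ^ q) s| = q * |φ s| ^ (q - 1) * |deriv φ s| := by
  have h := (hasDerivAt_abs_rpow (φ s) hq).comp s
    ((hφ.differentiable one_ne_zero s).hasDerivAt)
  have h' : HasDerivAt (fun s => |φ s| ^ q) (q * |φ s| ^ (q - 2) * φ s * deriv φ s) s := h
  refine ⟨h'.differentiableAt.hasDerivAt, ?_⟩
  rw [h'.deriv, abs_mul, abs_mul, abs_mul, abs_of_pos (by linarith : 0 < q),
    abs_of_nonneg (Real.rpow_nonneg (abs_nonneg _) _)]
  congr 1
  rcases eq_or_ne (φ s) 0 with h0 | h0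
  · simp [h0, Real.zero_rpow (by linarith : q - 1 ≠ 0)]
  · rw [mul_assoc, show q - 1 = (q - 2) + 1 by ring, Real.rpow_add_one (abs_ne_zero.2 h0)]

lemma aux_cd_pow {E : Type*} [NormedAddCommGroup E] [NormedSpace ℝ E] {φ : E → ℝ}
    (hφ : ContDiff ℝ 1 φ) {q : ℝ} (hq : 1 < q) :
    ContDiff ℝ 1 (fun s => |φ s| ^ q) := by
  simpa using hφ.norm_rpow hq

lemma aux_lineA {φ : ℝ → ℝ} (hφ : ContDiff ℝ 1 φ) {q L x : ℝ} (hq : 1 < q) (hL : 0 < L)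
    (hx : x ∈ Set.Icc 0 L) :
    ENNReal.ofReal (|φ x| ^ q) ≤ ∫⁻ s in Set.Ioo 0 L,
      ENNReal.ofReal (L⁻¹ * |φ s| ^ q + q * |φ s| ^ (q - 1) * |deriv φ s|) := by
  have hg := aux_cd_pow hφ hq
  obtain ⟨y, hy, hmin⟩ := isCompact_Icc.exists_isMinOn (Set.nonempty_Icc.2 hL.le)
    (hg.continuous.continuousOn (s := Set.Icc 0 L))
  have h1 := aux_ftc hg hx hy
  refine h1.trans ?_
  have h2 : ENNReal.ofReal (|φ y| ^ q) ≤
      ∫⁻ s in Set.Ioo 0 L, ENNReal.ofReal (L⁻¹ * |φ s| ^ q) := by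
    calc ENNReal.ofReal (|φ y| ^ q)
        = ∫⁻ s in Set.Ioo 0 L, ENNReal.ofReal (L⁻¹ * |φ y| ^ q) := by
          rw [setLIntegral_const, Real.volume_Ioo, ← ENNReal.ofReal_mul (by positivity)]
          congr 1; field_simp; ring
      _ ≤ _ := by
        apply setLIntegral_mono' measurableSet_Ioo
        intro s hs
        apply ENNReal.ofReal_le_ofReal
        have : |φ y| ^ q ≤ |φ s| ^ q := hmin (Set.Ioo_subset_Icc_self hs)
        gcongr
  refine (add_le_add h2 le_rfl).trans ?_
  rw [← lintegral_add_left]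
  · apply lintegral_mono
    intro s
    dsimp only
    rw [(aux_deriv_pow hφ hq s).2, ENNReal.ofReal_add (by positivity)]
    have : 0 ≤ q := by linarith
    positivity
  · exact (hg.continuous.measurable.const_mul _).ennreal_ofReal

lemma aux_lineB {v : ℝ → ℝ} (hv : ContDiff ℝ 1 v) {q b x : ℝ} (hq : 1 < q) (hb : 1 ≤ b)
    (hx : x ∈ Set.Icc 0 1) :
    ENNReal.ofReal (|v x| ^ q * x ^ b) ≤ ∫⁻ s in Set.Ioo (0:ℝ) 1,
      ENNReal.ofReal (q * |v s| ^ (q - 1) * |deriv v s| * s ^ b + b * (|v s| ^ q * s ^ (b - 1))) := by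
  have hg := aux_cd_pow hv hq
  have hp : ContDiff ℝ 1 (fun x : ℝ => x ^ b) := by
    have := Real.contDiff_rpow_const_of_le (p := b) (n := 1) (by simpa using hb)
    simpa using this
  have h1 := aux_ftc (hg.mul hp) hx (⟨le_rfl, zero_le_one⟩ : (0:ℝ) ∈ Set.Icc (0:ℝ) 1)
  simp only [Real.zero_rpow (by linarith : b ≠ 0), mul_zero, ENNReal.ofReal_zero, zero_add] at h1
  refine h1.trans ?_
  apply setLIntegral_mono' measurableSet_Ioo
  intro s hs
  apply ENNReal.ofReal_le_ofReal
  have hd := (aux_deriv_pow hv hq s).1.mul (Real.hasDerivAt_rpow_const (x := s) (p := b) (Or.inr hb))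
  have hd' := hd.deriv
  change |deriv (fun x => |v x| ^ q * x ^ b) s| ≤ _
  change deriv (fun x => |v x| ^ q * x ^ b) s = _ at hd'
  rw [hd']
  refine (abs_add_le _ _).trans ?_
  rw [abs_mul, (aux_deriv_pow hv hq s).2]
  have e1 : |s ^ b| = s ^ b := abs_of_nonneg (Real.rpow_nonneg hs.1.le _)
  have e2 : |(|v s| ^ q * (b * s ^ (b - 1)))| = |v s| ^ q * (b * s ^ (b - 1)) := by
    apply abs_of_nonneg
    have := Real.rpow_nonneg hs.1.le (b - 1)
    positivity
  rw [e1, e2]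
  apply le_of_eq; ring

lemma aux_hardy_w {w : ℝ → ℝ} (hw : ContDiff ℝ 1 w) (hw1 : w 1 = 0) {p c : ℝ} (hp : 1 < p)
    (hc : 0 < c) :
    ∫⁻ s in Set.Ioo (0:ℝ) 1, ENNReal.ofReal (|w s| ^ p * s ^ (c - 1)) ≤
      ENNReal.ofReal ((p / c) ^ p) *
        ∫⁻ s in Set.Ioo (0:ℝ) 1, ENNReal.ofReal (|deriv w s| ^ p * s ^ (c - 1 + p)) := by
  have hg := aux_cd_pow hw hp
  have hgc := hg.continuous
  have hdc : Continuous (deriv (fun s => |w s| ^ p)) := hg.continuous_deriv le_rfl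
  have hsc : Continuous (fun s : ℝ => s ^ c) := Real.continuous_rpow_const hc.le
  have hi1 : IntervalIntegrable (fun s => |w s| ^ p * s ^ (c - 1)) volume 0 1 :=
    (intervalIntegral.intervalIntegrable_rpow' (by linarith)).continuousOn_mul hgc.continuousOn
  have hi2 : IntervalIntegrable (fun s => deriv (fun s => |w s| ^ p) s * s ^ c) volume 0 1 :=
    (hdc.mul hsc).intervalIntegrable _ _
  have hftc : ∫ s in (0:ℝ)..1, (deriv (fun s => |w s| ^ p) s * s ^ c +
      c * (|w s| ^ p * s ^ (c - 1))) = |w 1| ^ p * (1:ℝ) ^ c - |w 0| ^ p * (0:ℝ) ^ c := by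
    apply intervalIntegral.integral_eq_sub_of_hasDerivAt_of_le (f := fun s => |w s| ^ p * s ^ c) zero_le_one
    · exact (hgc.mul hsc).continuousOn
    · intro s hs
      have := (aux_deriv_pow hw hp s).1.mul
        (Real.hasDerivAt_rpow_const (x := s) (p := c) (Or.inl hs.1.ne'))
      refine this.congr_deriv ?_
      ring
    · exact hi2.add (hi1.const_mul c)
  rw [intervalIntegral.integral_add hi2 (hi1.const_mul c), intervalIntegral.integral_const_mul, hw1,
    Real.zero_rpow hc.ne', abs_zero, Real.zero_rpow (by linarith)] at hftc
  have habs : c * ∫ s in (0:ℝ)..1, |w s| ^ p * s ^ (c - 1) ≤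
      ∫ s in (0:ℝ)..1, |deriv (fun s => |w s| ^ p) s * s ^ c| := by
    have h1 := intervalIntegral.norm_integral_le_integral_norm (μ := volume)
      (f := fun s => deriv (fun s => |w s| ^ p) s * s ^ c) (zero_le_one (α := ℝ))
    simp only [Real.norm_eq_abs] at h1
    have h2 := neg_abs_le (∫ s in (0:ℝ)..1, deriv (fun s => |w s| ^ p) s * s ^ c)
    linarith
  -- convert
  set J := ∫⁻ s in Set.Ioo (0:ℝ) 1, ENNReal.ofReal (|w s| ^ p * s ^ (c - 1)) with hJ
  set K := ∫⁻ s in Set.Ioo (0:ℝ) 1, ENNReal.ofReal (|deriv w s| ^ p * s ^ (c - 1 + p)) with hK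
  have hJ' : ENNReal.ofReal (∫ s in (0:ℝ)..1, |w s| ^ p * s ^ (c - 1)) = J := by
    rw [intervalIntegral.integral_of_le zero_le_one, integral_Ioc_eq_integral_Ioo,
      ofReal_integral_eq_lintegral_ofReal]
    · exact ((intervalIntegrable_iff_integrableOn_Ioo_of_le zero_le_one).1 hi1)
    · filter_upwards [ae_restrict_mem measurableSet_Ioo] with s hs
      have := Real.rpow_nonneg hs.1.le (c - 1)
      simp only [Pi.zero_apply]
      positivity
  have hJt : J ≠ ⊤ := by rw [← hJ']; exact ENNReal.ofReal_ne_top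
  have hR' : ENNReal.ofReal (∫ s in (0:ℝ)..1, |deriv (fun s => |w s| ^ p) s * s ^ c|) =
      ∫⁻ s in Set.Ioo (0:ℝ) 1, ENNReal.ofReal |deriv (fun s => |w s| ^ p) s * s ^ c| := by
    rw [intervalIntegral.integral_of_le zero_le_one, integral_Ioc_eq_integral_Ioo,
      ofReal_integral_eq_lintegral_ofReal]
    · exact ((intervalIntegrable_iff_integrableOn_Ioo_of_le zero_le_one).1 hi2.abs)
    · exact Filter.Eventually.of_forall fun s => abs_nonneg _
  have hpq : p.HolderConjugate (Real.conjExponent p) := Real.HolderConjugate.conjExponent hp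
  set p' := Real.conjExponent p with hp'
  have hp'0 : 0 < p' := hpq.symm.pos
  have hmain : ENNReal.ofReal c * J ≤ ENNReal.ofReal p * (K ^ (1 / p) * J ^ (1 / p')) := by
    rw [← hJ', ← ENNReal.ofReal_mul hc.le]
    refine (ENNReal.ofReal_le_ofReal habs).trans ?_
    rw [hR', hJ', hJ, hK]
    have hmd : Measurable (deriv w) := measurable_deriv w
    have hmw : Measurable w := hw.continuous.measurable
    have hH := ENNReal.lintegral_mul_le_Lp_mul_Lq (volume.restrict (Set.Ioo (0:ℝ) 1)) hpq
      (f := fun s => ENNReal.ofReal (|deriv w s| * s ^ ((c - 1 + p) / p)))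
      (g := fun s => ENNReal.ofReal (|w s| ^ (p - 1) * s ^ ((c - 1) / p')))
      (by fun_prop) (by fun_prop)
    have hE1 : ∫⁻ s in Set.Ioo (0:ℝ) 1, ENNReal.ofReal |deriv (fun s => |w s| ^ p) s * s ^ c| =
        ENNReal.ofReal p * ∫⁻ s in Set.Ioo (0:ℝ) 1,
         ((fun s => ENNReal.ofReal (|deriv w s| * s ^ ((c - 1 + p) / p))) *
          (fun s => ENNReal.ofReal (|w s| ^ (p - 1) * s ^ ((c - 1) / p')))) s := by
      rw [← lintegral_const_mul']
      · apply setLIntegral_congr_fun measurableSet_Ioo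
        intro s hs
        have hs0 := hs.1
        simp only [Pi.mul_apply]
        rw [← ENNReal.ofReal_mul (by positivity), ← ENNReal.ofReal_mul (by positivity)]
        congr 1
        rw [abs_mul, (aux_deriv_pow hw hp s).2, abs_of_nonneg (Real.rpow_nonneg hs0.le _)]
        have : s ^ c = s ^ ((c - 1 + p) / p) * s ^ ((c - 1) / p') := by
          rw [← Real.rpow_add hs0]
          congr 1
          have : (c - 1) / p' = (c - 1) - (c - 1) / p := by
            have := hpq.inv_add_inv_eq_one
            rw [div_eq_mul_inv, div_eq_mul_inv, ← mul_one_sub, ← this]; ring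
          rw [this]; field_simp; ring
        rw [this]; ring
      · exact ENNReal.ofReal_ne_top
    rw [hE1]
    gcongr
    refine hH.trans (le_of_eq ?_)
    congr 2
    · apply setLIntegral_congr_fun measurableSet_Ioo
      intro s hs
      have hs0 := hs.1
      simp only
      rw [ENNReal.ofReal_rpow_of_nonneg (by positivity) (by positivity),
        Real.mul_rpow (by positivity) (by positivity), ← Real.rpow_mul hs0.le,
        div_mul_cancel₀ _ (by positivity)]
    · apply setLIntegral_congr_fun measurableSet_Ioo
      intro s hs
      have hs0 := hs.1
      simp only
      rw [ENNReal.ofReal_rpow_of_nonneg (by positivity) (by positivity),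
        Real.mul_rpow (by positivity) (by positivity), ← Real.rpow_mul hs0.le,
        div_mul_cancel₀ _ (by positivity), ← Real.rpow_mul (abs_nonneg _), hpq.sub_one_mul_conj]
  have hJ2 : J ≤ (ENNReal.ofReal (p / c) * K ^ (1 / p)) * J ^ (1 / p') := by
    have hc0 : ENNReal.ofReal c ≠ 0 := by simpa using hc
    calc J = ENNReal.ofReal c⁻¹ * (ENNReal.ofReal c * J) := by
          rw [← mul_assoc, ← ENNReal.ofReal_mul (by positivity), inv_mul_cancel₀ hc.ne']; simp
      _ ≤ ENNReal.ofReal c⁻¹ * (ENNReal.ofReal p * (K ^ (1 / p) * J ^ (1 / p'))) := by gcongr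
      _ = _ := by
        rw [← mul_assoc, ← ENNReal.ofReal_mul (by positivity), ← mul_assoc]
        congr 3; field_simp
  have := aux_absorb hJ2 hJt (by rw [one_div]; exact inv_lt_one_of_one_lt₀ hpq.symm.lt)
  have he : 1 / (1 - 1 / p') = p := by
    have := hpq.inv_add_inv_eq_one
    rw [one_div p', show 1 - p'⁻¹ = p⁻¹ by linarith]; simp
  rw [he, ENNReal.mul_rpow_of_nonneg _ _ (by linarith), ← ENNReal.rpow_mul,
    one_div_mul_cancel (by linarith), ENNReal.rpow_one,
    ENNReal.ofReal_rpow_of_nonneg (by positivity) (by linarith)] at this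
  exact this

lemma aux_hardy {p c : ℝ} (hp : 1 < p) (hc : 0 < c) : ∃ C : ℝ, 0 < C ∧
    ∀ v : ℝ → ℝ, ContDiff ℝ 1 v →
    ∫⁻ s in Set.Ioo (0:ℝ) 1, ENNReal.ofReal (|v s| ^ p * s ^ (c - 1)) ≤
      ENNReal.ofReal C * ∫⁻ s in Set.Ioo (0:ℝ) 1,
        ENNReal.ofReal ((|deriv v s| ^ p + |v s| ^ p) * s ^ (c - 1 + p)) := by
  refine ⟨2 ^ p * ((p / c) ^ p * 2 ^ p + 1), by positivity, fun v hv => ?_⟩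
  have hw : ContDiff ℝ 1 (fun s => v s * (1 - s)) := by fun_prop
  have h1 := aux_hardy_w hw (by simp) hp hc
  have hmd : Measurable (deriv v) := measurable_deriv v
  have hmv : Measurable v := hv.continuous.measurable
  set R := ∫⁻ s in Set.Ioo (0:ℝ) 1,
        ENNReal.ofReal ((|deriv v s| ^ p + |v s| ^ p) * s ^ (c - 1 + p)) with hR
  have h2 : ∫⁻ s in Set.Ioo (0:ℝ) 1, ENNReal.ofReal (|deriv (fun s => v s * (1 - s)) s| ^ p * s ^ (c - 1 + p))
      ≤ ENNReal.ofReal (2 ^ p) * R := by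
    rw [hR, ← lintegral_const_mul' _ _ ENNReal.ofReal_ne_top]
    apply setLIntegral_mono' measurableSet_Ioo
    intro s hs
    rw [← ENNReal.ofReal_mul (by positivity)]
    apply ENNReal.ofReal_le_ofReal
    have hd : deriv (fun s => v s * (1 - s)) s = deriv v s * (1 - s) + v s * (-1) := by
      have a := (hv.differentiable one_ne_zero s).hasDerivAt
      have b : HasDerivAt (fun s : ℝ => 1 - s) (-1) s := by
        simpa using (hasDerivAt_id s).const_sub 1
      exact (a.mul b).deriv
    have hs0 := hs.1
    have hs1 := hs.2
    rw [← mul_assoc]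
    gcongr
    refine le_trans ?_ (aux_add_rpow (abs_nonneg _) (abs_nonneg _) (by linarith))
    gcongr
    rw [hd]
    refine (abs_add_le _ _).trans ?_
    rw [abs_mul, abs_mul, abs_of_pos (by linarith : 0 < 1 - s)]
    have := abs_nonneg (deriv v s)
    simp only [abs_neg, abs_one, mul_one]
    nlinarith
  have h3 : ∫⁻ s in Set.Ioo (0:ℝ) 1, ENNReal.ofReal (|v s| ^ p * s ^ (c - 1)) ≤
      ENNReal.ofReal (2 ^ p) * ((∫⁻ s in Set.Ioo (0:ℝ) 1, ENNReal.ofReal (|v s * (1 - s)| ^ p * s ^ (c - 1))) + R) := by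
    rw [hR, ← lintegral_add_left (by fun_prop), ← lintegral_const_mul' _ _ ENNReal.ofReal_ne_top]
    apply setLIntegral_mono' measurableSet_Ioo
    intro s hs
    have hs0 := hs.1
    have hs1 := hs.2
    rw [← ENNReal.ofReal_add (by positivity) (by positivity), ← ENNReal.ofReal_mul (by positivity)]
    apply ENNReal.ofReal_le_ofReal
    have e : |v s| = |v s * (1 - s)| + |v s| * s := by
      rw [abs_mul, abs_of_pos (by linarith : 0 < 1 - s)]; ring
    have k1 := aux_add_rpow (abs_nonneg (v s * (1 - s))) (mul_nonneg (abs_nonneg (v s)) hs0.le) (by linarith : 0 ≤ p)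
    rw [← e, Real.mul_rpow (abs_nonneg (v s)) hs0.le] at k1
    have k2 : s ^ (c - 1 + p) = s ^ (c - 1) * s ^ p := Real.rpow_add hs0 _ _
    rw [k2]
    have k3 : 0 < s ^ (c - 1) := by positivity
    have k4 : 0 ≤ |deriv v s| ^ p * (s ^ (c - 1) * s ^ p) := by positivity
    calc |v s| ^ p * s ^ (c - 1) ≤ (2 ^ p * (|v s * (1 - s)| ^ p + |v s| ^ p * s ^ p)) * s ^ (c - 1) := by gcongr
      _ = 2 ^ p * (|v s * (1 - s)| ^ p * s ^ (c - 1) + |v s| ^ p * (s ^ (c - 1) * s ^ p)) := by ring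
      _ ≤ _ := by
        gcongr
        have : 0 ≤ |deriv v s| ^ p := by positivity
        linarith
  calc _ ≤ _ := h3
    _ ≤ ENNReal.ofReal (2 ^ p) * (ENNReal.ofReal ((p / c) ^ p) * (ENNReal.ofReal (2 ^ p) * R) + R) := by
      gcongr
      exact h1.trans (by gcongr)
    _ = _ := by
      rw [ENNReal.ofReal_mul (by positivity), ENNReal.ofReal_add (by positivity) (by positivity),
        ENNReal.ofReal_mul (by positivity), ENNReal.ofReal_one]
      ring

/-- straightening map -/
def strFun (m : ℕ) (α : ℝ) (z : Fin (m+1) → ℝ) : Fin (m+1) → ℝ :=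
  fun i => if i = Fin.last m then z (Fin.last m) else z (Fin.last m) ^ α * z i

/-- open unit cube -/
def cubeQ (k : ℕ) : Set (Fin k → ℝ) := Set.univ.pi fun _ => Set.Ioo (0:ℝ) 1

/-- half open cusp -/
def cuspH (m : ℕ) (α : ℝ) : Set (Fin (m+1) → ℝ) :=
  {x | 0 < x (Fin.last m) ∧ x (Fin.last m) ≤ 1 ∧
    ∀ i, i ≠ Fin.last m → 0 ≤ x i ∧ x i ≤ x (Fin.last m) ^ α}

lemma strFun_last (m : ℕ) (α : ℝ) (z) : strFun m α z (Fin.last m) = z (Fin.last m) := by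
  simp [strFun]

lemma strFun_ne {m : ℕ} {α : ℝ} (z) {i} (hi : i ≠ Fin.last m) :
    strFun m α z i = z (Fin.last m) ^ α * z i := by
  simp [strFun, hi]

lemma strFun_contDiff {m : ℕ} {α : ℝ} (hα : 1 ≤ α) : ContDiff ℝ 1 (strFun m α) := by
  have hp : ContDiff ℝ 1 (fun x : ℝ => x ^ α) := by
    have := Real.contDiff_rpow_const_of_le (p := α) (n := 1) (by simpa using hα)
    simpa using this
  rw [contDiff_pi]
  intro i
  by_cases hi : i = Fin.last m
  · simp only [strFun, hi, if_true]
    fun_prop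
  · simp only [strFun, hi, if_false]
    have : ContDiff ℝ 1 (fun z : Fin (m+1) → ℝ => z (Fin.last m) ^ α) :=
      hp.comp (contDiff_apply ℝ ℝ (Fin.last m))
    exact this.mul (contDiff_apply ℝ ℝ i)

/-- derivative of the straightening map -/
def strD (m : ℕ) (α : ℝ) (z : Fin (m+1) → ℝ) : (Fin (m+1) → ℝ) →L[ℝ] (Fin (m+1) → ℝ) :=
  ContinuousLinearMap.pi fun i => if i = Fin.last m then ContinuousLinearMap.proj (Fin.last m) else
    (z (Fin.last m) ^ α) • ContinuousLinearMap.proj (R := ℝ) (φ := fun _ : Fin (m+1) => ℝ) i +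
    (z i) • ((α * z (Fin.last m) ^ (α - 1)) • ContinuousLinearMap.proj (R := ℝ) (φ := fun _ : Fin (m+1) => ℝ) (Fin.last m))

lemma strD_has {m : ℕ} {α : ℝ} (hα : 1 ≤ α) (z) :
    HasFDerivAt (strFun m α) (strD m α z) z := by
  rw [hasFDerivAt_pi']
  intro i
  have e : (ContinuousLinearMap.proj i).comp (strD m α z) = if i = Fin.last m then ContinuousLinearMap.proj (Fin.last m) else
    (z (Fin.last m) ^ α) • ContinuousLinearMap.proj (R := ℝ) (φ := fun _ : Fin (m+1) => ℝ) i +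
    (z i) • ((α * z (Fin.last m) ^ (α - 1)) • ContinuousLinearMap.proj (R := ℝ) (φ := fun _ : Fin (m+1) => ℝ) (Fin.last m)) := by
    ext w; simp [strD]
  rw [e]
  by_cases hi : i = Fin.last m
  · simp only [strFun, hi, if_true]
    exact hasFDerivAt_apply _ _
  · simp only [strFun, hi, if_false]
    have h1 : HasFDerivAt (fun z : Fin (m+1) → ℝ => z (Fin.last m)) (ContinuousLinearMap.proj (R := ℝ) (φ := fun _ : Fin (m+1) => ℝ) (Fin.last m)) z := hasFDerivAt_apply _ _
    have h2 := (Real.hasDerivAt_rpow_const (x := z (Fin.last m)) (p := α) (Or.inr hα)).comp_hasFDerivAt z h1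
    exact h2.mul (hasFDerivAt_apply i z)

lemma strD_det {m : ℕ} {α : ℝ} (z) (hz : 0 < z (Fin.last m)) :
    (strD m α z).det = z (Fin.last m) ^ (α * m) := by
  rw [ContinuousLinearMap.det, ← LinearMap.det_toMatrix']
  rw [Matrix.det_of_isUpperTriangular]
  · rw [Fin.prod_univ_castSucc]
    have h1 : ∀ i : Fin m, (LinearMap.toMatrix' (strD m α z : (Fin (m+1) → ℝ) →ₗ[ℝ] (Fin (m+1) → ℝ))) i.castSucc i.castSucc = z (Fin.last m) ^ α := by
      intro i
      have : i.castSucc ≠ Fin.last m := (Fin.castSucc_lt_last i).ne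
      simp [LinearMap.toMatrix'_apply, strD, this, this.symm]
    have h2 : (LinearMap.toMatrix' (strD m α z : (Fin (m+1) → ℝ) →ₗ[ℝ] (Fin (m+1) → ℝ))) (Fin.last m) (Fin.last m) = 1 := by
      simp [LinearMap.toMatrix'_apply, strD]
    rw [Finset.prod_congr rfl (fun i _ => h1 i), h2]
    simp [Real.rpow_mul hz.le]
  · intro i j hij
    have hij : j < i := hij
    have hj : j ≠ Fin.last m := (hij.trans_le (Fin.le_last i)).ne
    by_cases hi : i = Fin.last m
    · simp [LinearMap.toMatrix'_apply, strD, hi, hj.symm]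
    · simp [LinearMap.toMatrix'_apply, strD, hi, hj.symm, hij.ne']

lemma strFun_inj {m : ℕ} {α : ℝ} {B : Set (Fin (m+1) → ℝ)} (hB : ∀ z ∈ B, 0 < z (Fin.last m)) :
    Set.InjOn (strFun m α) B := by
  intro z hz w hw h
  have hl : z (Fin.last m) = w (Fin.last m) := by
    have := congrFun h (Fin.last m)
    simpa [strFun_last] using this
  funext i
  by_cases hi : i = Fin.last m
  · rw [hi, hl]
  · have := congrFun h i
    rw [strFun_ne _ hi, strFun_ne _ hi, hl] at this
    exact mul_left_cancel₀ (Real.rpow_pos_of_pos (hB w hw) α).ne' this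

lemma str_cov {m : ℕ} {α : ℝ} (hα : 1 ≤ α) {B : Set (Fin (m+1) → ℝ)} (hBm : MeasurableSet B)
    (hB : ∀ z ∈ B, 0 < z (Fin.last m)) (f : (Fin (m+1) → ℝ) → ℝ≥0∞) :
    ∫⁻ x in strFun m α '' B, f x =
      ∫⁻ z in B, ENNReal.ofReal (z (Fin.last m) ^ (α * m)) * f (strFun m α z) := by
  rw [lintegral_image_eq_lintegral_abs_det_fderiv_mul volume hBm
    (fun z _ => (strD_has hα z).hasFDerivWithinAt) (strFun_inj hB)]
  apply setLIntegral_congr_fun hBm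
  intro z hz
  simp only
  rw [strD_det z (hB z hz), abs_of_nonneg (Real.rpow_nonneg (hB z hz).le _)]

lemma cubeQ_meas (k : ℕ) : MeasurableSet (cubeQ k) :=
  MeasurableSet.univ_pi fun _ => measurableSet_Ioo

lemma mem_cubeQ {k : ℕ} {z : Fin k → ℝ} : z ∈ cubeQ k ↔ ∀ i, 0 < z i ∧ z i < 1 := by
  simp [cubeQ]

lemma cubeQ_ae (k : ℕ) : (cubeQ k : Set (Fin k → ℝ)) =ᵐ[volume] Set.Icc (fun _ => (0:ℝ)) (fun _ => 1) := by
  have := Measure.univ_pi_Ioo_ae_eq_Icc (μ := fun _ : Fin k => (volume : Measure ℝ)) (f := fun _ => (0:ℝ)) (g := fun _ => 1)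
  exact this

/-- half-open cube -/
def cubeH (m : ℕ) : Set (Fin (m+1) → ℝ) :=
  {z | (∀ i, 0 ≤ z i ∧ z i ≤ 1) ∧ 0 < z (Fin.last m)}

lemma cubeH_meas (m : ℕ) : MeasurableSet (cubeH m) := by
  have : cubeH m = Set.Icc (fun _ => (0:ℝ)) (fun _ => 1) ∩ {z | 0 < z (Fin.last m)} := by
    ext z; simp [cubeH, Set.mem_Icc, Pi.le_def, forall_and]
  rw [this]
  exact measurableSet_Icc.inter (measurableSet_lt measurable_const (measurable_pi_apply _))

lemma cubeH_ae (m : ℕ) : (cubeH m : Set (Fin (m+1) → ℝ)) =ᵐ[volume] cubeQ (m+1) := by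
  have h1 : cubeQ (m+1) ⊆ cubeH m := fun z hz => by
    rw [mem_cubeQ] at hz
    exact ⟨fun i => ⟨(hz i).1.le, (hz i).2.le⟩, (hz _).1⟩
  have h2 : cubeH m ⊆ Set.Icc (fun _ => (0:ℝ)) (fun _ => 1) := fun z hz =>
    ⟨fun i => (hz.1 i).1, fun i => (hz.1 i).2⟩
  apply Filter.EventuallyLE.antisymm
  · exact (HasSubset.Subset.eventuallyLE h2).trans (cubeQ_ae (m+1)).symm.le
  · exact HasSubset.Subset.eventuallyLE h1

lemma image_cubeH {m : ℕ} {α : ℝ} : strFun m α '' cubeH m = cuspH m α := by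
  ext x
  constructor
  · rintro ⟨z, hz, rfl⟩
    refine ⟨by rw [strFun_last]; exact hz.2, by rw [strFun_last]; exact (hz.1 _).2, fun i hi => ?_⟩
    rw [strFun_last, strFun_ne _ hi]
    have := Real.rpow_pos_of_pos hz.2 α
    have := hz.1 i
    constructor
    · exact mul_nonneg (by positivity) this.1
    · exact mul_le_of_le_one_right (by positivity) this.2
  · rintro ⟨h0, h1, h⟩
    have hp := Real.rpow_pos_of_pos h0 α
    refine ⟨fun i => if i = Fin.last m then x (Fin.last m) else x i / x (Fin.last m) ^ α, ⟨fun i => ?_, by simpa using h0⟩, ?_⟩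
    · by_cases hi : i = Fin.last m
      · simp [hi, h0.le, h1]
      · simp only [hi, if_false]
        exact ⟨div_nonneg (h i hi).1 hp.le, (div_le_one hp).2 (h i hi).2⟩
    · funext i
      by_cases hi : i = Fin.last m
      · simp [hi, strFun_last]
      · rw [strFun_ne _ hi]; simp only [hi, if_true, if_false]
        field_simp

lemma image_cubeQ {m : ℕ} {α : ℝ} : strFun m α '' cubeQ (m+1) =
    {x | 0 < x (Fin.last m) ∧ x (Fin.last m) < 1 ∧
    ∀ i, i ≠ Fin.last m → 0 < x i ∧ x i < x (Fin.last m) ^ α} := by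
  ext x
  constructor
  · rintro ⟨z, hz, rfl⟩
    rw [mem_cubeQ] at hz
    refine ⟨by rw [strFun_last]; exact (hz _).1, by rw [strFun_last]; exact (hz _).2, fun i hi => ?_⟩
    rw [strFun_last, strFun_ne _ hi]
    have := Real.rpow_pos_of_pos (hz (Fin.last m)).1 α
    constructor
    · exact mul_pos (by positivity) (hz i).1
    · exact mul_lt_of_lt_one_right (by positivity) (hz i).2
  · rintro ⟨h0, h1, h⟩
    have hp := Real.rpow_pos_of_pos h0 α
    refine ⟨fun i => if i = Fin.last m then x (Fin.last m) else x i / x (Fin.last m) ^ α, mem_cubeQ.2 fun i => ?_, ?_⟩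
    · by_cases hi : i = Fin.last m
      · simp [hi, h0, h1]
      · simp only [hi, if_false]
        exact ⟨div_pos (h i hi).1 hp, (div_lt_one hp).2 (h i hi).2⟩
    · funext i
      by_cases hi : i = Fin.last m
      · simp [hi, strFun_last]
      · rw [strFun_ne _ hi]; simp only [hi, if_true, if_false]
        field_simp

lemma cov_half {m : ℕ} {α : ℝ} (hα : 1 ≤ α) (f : (Fin (m+1) → ℝ) → ℝ≥0∞) :
    ∫⁻ x in cuspH m α, f x =
      ∫⁻ z in cubeQ (m+1), ENNReal.ofReal (z (Fin.last m) ^ (α * m)) * f (strFun m α z) := by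
  rw [← image_cubeH, str_cov hα (cubeH_meas m) (fun z hz => hz.2), setLIntegral_congr (cubeH_ae m)]

/-- straightening into Euclidean space -/
def strE (m : ℕ) (α : ℝ) (z : Fin (m+1) → ℝ) : EuclideanSpace ℝ (Fin (m+1)) :=
  WithLp.toLp 2 (strFun m α z)

lemma cov_open {m : ℕ} {α : ℝ} (hα : 1 ≤ α) (S : Set (EuclideanSpace ℝ (Fin (m+1))))
    (hS : ∀ x, x ∈ S ↔ 0 < x (Fin.last m) ∧ x (Fin.last m) < 1 ∧
    ∀ i, i ≠ Fin.last m → 0 < x i ∧ x i < x (Fin.last m) ^ α) (f : EuclideanSpace ℝ (Fin (m+1)) → ℝ≥0∞) :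
    ∫⁻ x in S, f x =
      ∫⁻ z in cubeQ (m+1), ENNReal.ofReal (z (Fin.last m) ^ (α * m)) * f (strE m α z) := by
  unfold strE
  rw [← str_cov hα (cubeQ_meas _) (fun z hz => (mem_cubeQ.1 hz _).1) (fun z => f (WithLp.toLp 2 z)), image_cubeQ]
  have h := PiLp.volume_preserving_toLp (Fin (m+1))
  rw [← h.setLIntegral_comp_preimage_emb (MeasurableEquiv.toLp 2 (Fin (m+1) → ℝ)).measurableEmbedding]
  congr 2
  ext x
  exact hS _

/-- the key integrand -/
def trF (m : ℕ) (α q b : ℝ) (u : EuclideanSpace ℝ (Fin (m+1)) → ℝ) (z : Fin (m+1) → ℝ) : ℝ :=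
  |u (strE m α z)| ^ (q - 1) * ‖fderiv ℝ u (strE m α z)‖ * z (Fin.last m) ^ b
    + |u (strE m α z)| ^ q * z (Fin.last m) ^ (b - 1)

lemma strE_contDiff {m : ℕ} {α : ℝ} (hα : 1 ≤ α) : ContDiff ℝ 1 (strE m α) :=
  (PiLp.contDiff_toLp (𝕜 := ℝ) (p := 2) (n := 1)).comp (strFun_contDiff hα)

lemma strE_line {m : ℕ} {α : ℝ} (hα : 1 ≤ α) {u : EuclideanSpace ℝ (Fin (m+1)) → ℝ}
    (hu : ContDiff ℝ 1 u) (z : Fin (m+1) → ℝ) (i : Fin (m+1)) :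
    ContDiff ℝ 1 (fun s => u (strE m α (Function.update z i s))) :=
  hu.comp ((strE_contDiff hα).comp (contDiff_update 1 z i))

lemma strE_line_deriv {m : ℕ} {α : ℝ} (hα : 1 ≤ α) {u : EuclideanSpace ℝ (Fin (m+1)) → ℝ}
    (hu : ContDiff ℝ 1 u) (z : Fin (m+1) → ℝ) (i : Fin (m+1)) (s : ℝ) :
    |deriv (fun s => u (strE m α (Function.update z i s))) s| ≤
      ‖fderiv ℝ u (strE m α (Function.update z i s))‖ *
      ‖(WithLp.toLp 2 (strD m α (Function.update z i s) (Pi.single i 1)) : EuclideanSpace ℝ (Fin (m+1)))‖ := by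
  have h1 : HasDerivAt (fun s => Function.update z i s) (Pi.single i 1) s := hasDerivAt_update z i s
  have h2 := (strD_has hα (Function.update z i s)).comp_hasDerivAt s h1
  have h3 : HasFDerivAt (WithLp.toLp 2 : (Fin (m+1) → ℝ) → EuclideanSpace ℝ (Fin (m+1)))
    ((PiLp.continuousLinearEquiv 2 ℝ (fun _ : Fin (m+1) => ℝ)).symm : (Fin (m+1) → ℝ) →L[ℝ] EuclideanSpace ℝ (Fin (m+1)))
    (strFun m α (Function.update z i s)) :=
    ((PiLp.continuousLinearEquiv 2 ℝ (fun _ : Fin (m+1) => ℝ)).symm).hasFDerivAt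
  have h4 := h3.comp_hasDerivAt s h2
  have h5 := ((hu.differentiable one_ne_zero) (strE m α (Function.update z i s))).hasFDerivAt.comp_hasDerivAt s h4
  have h6 := h5.deriv
  change deriv (fun s => u (strE m α (Function.update z i s))) s = _ at h6
  rw [h6]
  exact (fderiv ℝ u (strE m α (Function.update z i s))).le_opNorm _

lemma strD_norm_ne {m : ℕ} {α : ℝ} (z : Fin (m+1) → ℝ) {i : Fin (m+1)} (hi : i ≠ Fin.last m)
    (hz : 0 ≤ z (Fin.last m)) :
    ‖(WithLp.toLp 2 (strD m α z (Pi.single i 1)) : EuclideanSpace ℝ (Fin (m+1)))‖ = z (Fin.last m) ^ α := by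
  have : strD m α z (Pi.single i 1) = Pi.single i (z (Fin.last m) ^ α) := by
    funext j
    by_cases hj : j = Fin.last m
    · subst hj; simp [strD, hi.symm]
    · by_cases hij : j = i
      · subst hij; simp [strD, hi.symm, hj]
      · simp [strD, hi.symm, hj, hij]
  rw [this]
  have := EuclideanSpace.norm_single (𝕜 := ℝ) i (z (Fin.last m) ^ α)
  rw [Real.norm_eq_abs, abs_of_nonneg (Real.rpow_nonneg hz _)] at this
  exact this

lemma strD_norm_last {m : ℕ} {α : ℝ} (hα : 1 ≤ α) (z : Fin (m+1) → ℝ)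
    (hz : ∀ i, 0 ≤ z i ∧ z i ≤ 1) :
    ‖(WithLp.toLp 2 (strD m α z (Pi.single (Fin.last m) 1)) : EuclideanSpace ℝ (Fin (m+1)))‖ ≤ (m + 1) * α := by
  have hj : ∀ j, |strD m α z (Pi.single (Fin.last m) 1) j| ≤ α := by
    intro j
    by_cases hj : j = Fin.last m
    · subst hj; simp [strD, hα]
    · have h0 := Real.rpow_nonneg (hz (Fin.last m)).1 (α - 1)
      have h1 := Real.rpow_le_one (hz (Fin.last m)).1 (hz (Fin.last m)).2 (by linarith : 0 ≤ α - 1)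
      have e : strD m α z (Pi.single (Fin.last m) 1) j = z j * (α * z (Fin.last m) ^ (α - 1)) := by
        simp [strD, hj]
      rw [e, abs_of_nonneg (mul_nonneg (hz j).1 (by positivity))]
      calc _ ≤ 1 * (α * 1) := by
            gcongr
            exact (hz j).2
        _ = α := by ring
  rw [EuclideanSpace.norm_eq, Real.sqrt_le_iff]
  refine ⟨by positivity, ?_⟩
  calc _ ≤ ∑ j : Fin (m+1), α ^ 2 := by
        apply Finset.sum_le_sum
        intro j _
        rw [Real.norm_eq_abs]
        exact pow_le_pow_left₀ (abs_nonneg _) (hj j) 2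
    _ = (m + 1) * α ^ 2 := by simp
    _ ≤ _ := by
      rw [mul_pow]
      gcongr
      have : (0:ℝ) ≤ m := by positivity
      nlinarith

lemma gridA {m : ℕ} {α q b : ℝ} (hα : 1 ≤ α) (hq : 1 < q) (hb : 1 ≤ b)
    {u : EuclideanSpace ℝ (Fin (m+1)) → ℝ} (hu : ContDiff ℝ 1 u) {z : Fin (m+1) → ℝ}
    (hz : z ∈ cubeQ (m+1)) {i : Fin (m+1)} (hi : i ≠ Fin.last m) :
    ENNReal.ofReal (|u (strE m α z)| ^ q * z (Fin.last m) ^ (b - 1)) ≤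
      ENNReal.ofReal (q + 1) * ∫⁻ s in Set.Ioo (0:ℝ) 1, ENNReal.ofReal (trF m α q b u (Function.update z i s)) := by
  rw [mem_cubeQ] at hz
  have ht := hz (Fin.last m)
  have h := aux_lineA (strE_line hα hu z i) hq one_pos (x := z i) ⟨(hz i).1.le, (hz i).2.le⟩
  simp only [Function.update_eq_self] at h
  have ht0 := ht.1
  rw [mul_comm, ENNReal.ofReal_mul (by positivity)]
  refine (mul_le_mul_right h _).trans ?_
  rw [← lintegral_const_mul' _ _ ENNReal.ofReal_ne_top, ← lintegral_const_mul' _ _ ENNReal.ofReal_ne_top]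
  apply lintegral_mono
  intro s
  dsimp only
  rw [← ENNReal.ofReal_mul (by positivity), ← ENNReal.ofReal_mul (by positivity)]
  apply ENNReal.ofReal_le_ofReal
  have hd := strE_line_deriv hα hu z i s
  have hlast : Function.update z i s (Fin.last m) = z (Fin.last m) := by
    rw [Function.update_of_ne hi.symm]
  rw [strD_norm_ne _ hi (by rw [hlast]; exact ht.1.le), hlast] at hd
  unfold trF
  rw [hlast]
  set t := z (Fin.last m)
  set A := |u (strE m α (Function.update z i s))|
  set G := ‖fderiv ℝ u (strE m α (Function.update z i s))‖
  have hta : t ^ α ≤ t := by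
    calc t ^ α ≤ t ^ (1:ℝ) := Real.rpow_le_rpow_of_exponent_ge ht0 ht.2.le hα
      _ = t := Real.rpow_one t
  have htb : t ^ b = t ^ (b - 1) * t := by
    rw [← Real.rpow_add_one ht0.ne']; congr 1; ring
  have hG : 0 ≤ G := norm_nonneg _
  have hA : 0 ≤ A := abs_nonneg _
  calc _ ≤ t ^ (b - 1) * (1⁻¹ * A ^ q + q * A ^ (q - 1) * (G * t)) := by
        gcongr
        exact hd.trans (by gcongr)
    _ = q * (A ^ (q - 1) * G * t ^ b) + A ^ q * t ^ (b - 1) := by rw [htb]; ring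
    _ ≤ _ := by
      have k1 : 0 ≤ A ^ (q - 1) * G * t ^ b := by positivity
      have k2 : 0 ≤ A ^ q * t ^ (b - 1) := by positivity
      nlinarith

lemma gridB {m : ℕ} {α q b : ℝ} (hα : 1 ≤ α) (hq : 1 < q) (hb : 1 ≤ b)
    {u : EuclideanSpace ℝ (Fin (m+1)) → ℝ} (hu : ContDiff ℝ 1 u) {z : Fin (m+1) → ℝ}
    (hz : ∀ i, 0 ≤ z i ∧ z i ≤ 1) :
    ENNReal.ofReal (|u (strE m α z)| ^ q * z (Fin.last m) ^ b) ≤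
      ENNReal.ofReal (q * ((m + 1) * α) + b) * ∫⁻ s in Set.Ioo (0:ℝ) 1,
        ENNReal.ofReal (trF m α q b u (Function.update z (Fin.last m) s)) := by
  have h := aux_lineB (strE_line hα hu z (Fin.last m)) hq hb (x := z (Fin.last m)) (hz _)
  simp only [Function.update_eq_self] at h
  refine h.trans ?_
  rw [← lintegral_const_mul' _ _ ENNReal.ofReal_ne_top]
  apply setLIntegral_mono' measurableSet_Ioo
  intro s hs
  have hs0 := hs.1
  rw [← ENNReal.ofReal_mul (by positivity)]
  apply ENNReal.ofReal_le_ofReal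
  have hd := strE_line_deriv hα hu z (Fin.last m) s
  have hd2 := strD_norm_last hα (Function.update z (Fin.last m) s) (by
    intro i
    by_cases hi : i = Fin.last m
    · subst hi; simp [hs.1.le, hs.2.le]
    · rw [Function.update_of_ne hi]; exact hz i)
  unfold trF
  rw [Function.update_self]
  set A := |u (strE m α (Function.update z (Fin.last m) s))|
  set G := ‖fderiv ℝ u (strE m α (Function.update z (Fin.last m) s))‖
  have hG : 0 ≤ G := norm_nonneg _
  have hA : 0 ≤ A := abs_nonneg _
  have k1 : 0 ≤ A ^ (q - 1) * G * s ^ b := by positivity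
  have k2 : 0 ≤ A ^ q * s ^ (b - 1) := by positivity
  calc _ ≤ q * A ^ (q - 1) * (G * ((m + 1) * α)) * s ^ b + b * (A ^ q * s ^ (b - 1)) := by
        gcongr
        exact hd.trans (by gcongr)
    _ = (q * ((m + 1) * α)) * (A ^ (q - 1) * G * s ^ b) + b * (A ^ q * s ^ (b - 1)) := by ring
    _ ≤ _ := by
      have : 0 ≤ q * ((m + 1) * α) := by positivity
      nlinarith [mul_nonneg this k2]

lemma trF_cont {m : ℕ} {α q b : ℝ} (hα : 1 ≤ α) (hq : 1 < q) (hb : 1 ≤ b)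
    {u : EuclideanSpace ℝ (Fin (m+1)) → ℝ} (hu : ContDiff ℝ 1 u) : Continuous (trF m α q b u) := by
  have h1 : Continuous (fun z => u (strE m α z)) := hu.continuous.comp (strE_contDiff hα).continuous
  have h2 : Continuous (fun z => fderiv ℝ u (strE m α z)) :=
    (hu.continuous_fderiv one_ne_zero).comp (strE_contDiff hα).continuous
  have h3 : Continuous (fun z : Fin (m+1) → ℝ => z (Fin.last m)) := continuous_apply _
  unfold trF
  refine Continuous.add (Continuous.mul (Continuous.mul ?_ h2.norm) ?_) (Continuous.mul ?_ ?_)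
  · exact h1.abs.rpow_const fun _ => Or.inr (by linarith)
  · exact h3.rpow_const fun _ => Or.inr (by linarith)
  · exact h1.abs.rpow_const fun _ => Or.inr (by linarith)
  · exact h3.rpow_const fun _ => Or.inr (by linarith)

lemma trF_fin {m : ℕ} {α q b : ℝ} (hα : 1 ≤ α) (hq : 1 < q) (hb : 1 ≤ b)
    {u : EuclideanSpace ℝ (Fin (m+1)) → ℝ} (hu : ContDiff ℝ 1 u) :
    ∫⁻ z in cubeQ (m+1), ENNReal.ofReal (trF m α q b u z) ≠ ⊤ := by
  rw [setLIntegral_congr (cubeQ_ae (m+1))]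
  have hi : IntegrableOn (trF m α q b u) (Set.Icc (fun _ => (0:ℝ)) (fun _ => 1)) volume :=
    (trF_cont hα hq hb hu).continuousOn.integrableOn_compact isCompact_Icc
  exact (hi.lintegral_lt_top).ne

lemma cubeQ_restrict (k : ℕ) : (volume : Measure (Fin k → ℝ)).restrict (cubeQ k) =
    Measure.pi (fun _ => (volume : Measure ℝ).restrict (Set.Ioo 0 1)) := by
  rw [cubeQ, volume_pi, Measure.restrict_pi_pi]

lemma sobolev {m : ℕ} {α q b : ℝ} (hm : 1 ≤ m) (hα : 1 ≤ α) (hq : 1 < q) (hb : 1 ≤ b) :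
    ∃ C : ℝ, 0 < C ∧ ∀ u : EuclideanSpace ℝ (Fin (m+1)) → ℝ, ContDiff ℝ 1 u →
    ∫⁻ z in cubeQ (m+1), ENNReal.ofReal (|u (strE m α z)| ^ (q + q / m) * z (Fin.last m) ^ (b - 1 + b / m))
     ≤ ENNReal.ofReal C * (∫⁻ z in cubeQ (m+1), ENNReal.ofReal (trF m α q b u z)) ^ (((m:ℝ) + 1) / m) := by
  have hm0 : (0:ℝ) < m := by exact_mod_cast hm
  set K : ℝ := (q + 1) + (q * ((m + 1) * α) + b) with hK
  have hKpos : 0 < K := by positivity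
  refine ⟨(K ^ (1 / (m:ℝ))) ^ (m + 1), by positivity, fun u hu => ?_⟩
  have hc := trF_cont hα hq hb hu
  have hgrid := lintegral_prod_lintegral_pow_le (ι := Fin (m+1)) (A := fun _ => ℝ)
    (fun _ => (volume : Measure ℝ).restrict (Set.Ioo 0 1)) (p := ((m:ℝ) + 1) / m)
    (by
      rw [Real.holderConjugate_iff]
      simp only [Fintype.card_fin]
      push_cast
      refine ⟨by linarith, ?_⟩
      field_simp; ring)
    (f := fun z => ENNReal.ofReal (trF m α q b u z)) hc.measurable.ennreal_ofReal
  rw [← cubeQ_restrict] at hgrid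
  have e1 : (1:ℝ) / ((Fintype.card (Fin (m+1)) : ℝ) - 1) = 1 / m := by simp
  rw [e1] at hgrid
  refine le_trans ?_ (mul_le_mul_right hgrid _)
  rw [← lintegral_const_mul' _ _ ENNReal.ofReal_ne_top]
  apply setLIntegral_mono' (cubeQ_meas _)
  intro z hz
  have hz' := mem_cubeQ.1 hz
  set t := z (Fin.last m) with htdef
  have ht0 : 0 < t := (hz' _).1
  set A := |u (strE m α z)| with hAdef
  have hA : 0 ≤ A := abs_nonneg _
  set J : Fin (m+1) → ℝ≥0∞ := fun i => ∫⁻ s in Set.Ioo (0:ℝ) 1, ENNReal.ofReal (trF m α q b u (Function.update z i s)) with hJ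
  have hX : ∀ i : Fin m, ENNReal.ofReal (A ^ q * t ^ (b - 1)) ≤ ENNReal.ofReal K * J i.castSucc := by
    intro i
    refine (gridA hα hq hb hu hz (Fin.castSucc_lt_last i).ne).trans ?_
    gcongr
    rw [hK]
    have : 0 ≤ q * ((m + 1) * α) + b := by positivity
    linarith
  have hY : ENNReal.ofReal (A ^ q * t ^ b) ≤ ENNReal.ofReal K * J (Fin.last m) := by
    refine (gridB hα hq hb hu (fun i => ⟨(hz' i).1.le, (hz' i).2.le⟩)).trans ?_
    gcongr
    rw [hK]
    linarith
  have hm' : 0 ≤ 1 / (m:ℝ) := by positivity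
  calc ENNReal.ofReal (A ^ (q + q / m) * t ^ (b - 1 + b / m))
      = ENNReal.ofReal (A ^ q * t ^ (b - 1)) * ENNReal.ofReal (A ^ q * t ^ b) ^ (1 / (m:ℝ)) := by
        rw [ENNReal.ofReal_rpow_of_nonneg (by positivity) hm', ← ENNReal.ofReal_mul (by positivity),
          Real.rpow_add ht0, Real.mul_rpow (by positivity) (by positivity),
          ← Real.rpow_mul hA, ← Real.rpow_mul ht0.le, mul_one_div, mul_one_div,
          Real.rpow_add_of_nonneg hA (by positivity) (by positivity)]
        congr 1; ring
    _ = (∏ i : Fin m, ENNReal.ofReal (A ^ q * t ^ (b - 1)) ^ (1 / (m:ℝ))) * ENNReal.ofReal (A ^ q * t ^ b) ^ (1 / (m:ℝ)) := by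
        rw [Finset.prod_const, Finset.card_univ, Fintype.card_fin, ← ENNReal.rpow_mul_natCast,
          one_div_mul_cancel hm0.ne', ENNReal.rpow_one]
    _ ≤ (∏ i : Fin m, (ENNReal.ofReal K * J i.castSucc) ^ (1 / (m:ℝ))) * (ENNReal.ofReal K * J (Fin.last m)) ^ (1 / (m:ℝ)) := by
        gcongr with i
        exact hX i
    _ = ∏ i : Fin (m+1), (ENNReal.ofReal K * J i) ^ (1 / (m:ℝ)) := by rw [Fin.prod_univ_castSucc]
    _ = _ := by
      simp_rw [ENNReal.mul_rpow_of_nonneg _ _ hm']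
      rw [Finset.prod_mul_distrib, Finset.prod_const, Finset.card_univ, Fintype.card_fin,
        ENNReal.ofReal_rpow_of_pos hKpos, ← ENNReal.ofReal_pow (by positivity)]

lemma aux_fub {m : ℕ} (i : Fin (m+1)) {f : (Fin (m+1) → ℝ) → ℝ≥0∞} (hf : Measurable f) :
    ∫⁻ z in cubeQ (m+1), f z =
      ∫⁻ y in cubeQ m, ∫⁻ s in Set.Ioo (0:ℝ) 1, f (i.insertNth s y) := by
  rw [cubeQ_restrict, cubeQ_restrict]
  have h := measurePreserving_piFinSuccAbove (fun _ : Fin (m+1) => (volume : Measure ℝ).restrict (Set.Ioo 0 1)) i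
  have h' := h.symm
  rw [← h'.lintegral_comp hf, lintegral_prod_symm]
  · rfl
  · exact (hf.comp (MeasurableEquiv.measurable _)).aemeasurable

lemma aux_insert_eq_update {m : ℕ} (i : Fin (m+1)) (s : ℝ) (y : Fin m → ℝ) :
    (i.insertNth s y : Fin (m+1) → ℝ) = Function.update (i.insertNth (0:ℝ) y : Fin (m+1) → ℝ) i s := by
  rw [Fin.update_insertNth]

lemma aux_insert_mem {m : ℕ} (i : Fin (m+1)) {s : ℝ} {y : Fin m → ℝ} (hy : y ∈ cubeQ m)
    (hs : 0 ≤ s ∧ s ≤ 1) (j : Fin (m+1)) :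
    0 ≤ (i.insertNth s y : Fin (m+1) → ℝ) j ∧ (i.insertNth s y : Fin (m+1) → ℝ) j ≤ 1 := by
  rw [mem_cubeQ] at hy
  by_cases hj : j = i
  · subst hj; simpa using hs
  · obtain ⟨k, rfl⟩ := Fin.exists_succAbove_eq hj
    rw [Fin.insertNth_apply_succAbove]
    exact ⟨(hy k).1.le, (hy k).2.le⟩

/-- gradient energy plus function energy in straightened coordinates -/
def enD (m : ℕ) (α p : ℝ) (u : EuclideanSpace ℝ (Fin (m+1)) → ℝ) : ℝ≥0∞ :=
  (∫⁻ z in cubeQ (m+1), ENNReal.ofReal (z (Fin.last m) ^ (α * m)) * ENNReal.ofReal (‖fderiv ℝ u (strE m α z)‖ ^ p)) +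
  ∫⁻ z in cubeQ (m+1), ENNReal.ofReal (z (Fin.last m) ^ (α * m)) * ENNReal.ofReal (|u (strE m α z)| ^ p)

lemma meas_u {m : ℕ} {α : ℝ} (hα : 1 ≤ α) {u : EuclideanSpace ℝ (Fin (m+1)) → ℝ}
    (hu : ContDiff ℝ 1 u) : Measurable (fun z => u (strE m α z)) :=
  (hu.continuous.comp (strE_contDiff hα).continuous).measurable

lemma meas_du {m : ℕ} {α : ℝ} (hα : 1 ≤ α) {u : EuclideanSpace ℝ (Fin (m+1)) → ℝ}
    (hu : ContDiff ℝ 1 u) : Measurable (fun z => ‖fderiv ℝ u (strE m α z)‖) :=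
  ((hu.continuous_fderiv one_ne_zero).comp (strE_contDiff hα).continuous).norm.measurable

lemma hardy_cube {m : ℕ} {α p : ℝ} (hα : 1 ≤ α) (hp : 1 < p) (hpm : p < m + 1) :
    ∃ C : ℝ, 0 < C ∧ ∀ u : EuclideanSpace ℝ (Fin (m+1)) → ℝ, ContDiff ℝ 1 u →
    ∫⁻ z in cubeQ (m+1), ENNReal.ofReal (|u (strE m α z)| ^ p * z (Fin.last m) ^ (α * m - p)) ≤
      ENNReal.ofReal C * enD m α p u := by
  have hc : 0 < α * m - p + 1 := by
    have : (m:ℝ) ≤ α * m := le_mul_of_one_le_left (by positivity) hα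
    linarith
  obtain ⟨C, hC, hardy⟩ := aux_hardy hp hc
  set K : ℝ := (m + 1) * α with hK
  have hK1 : 1 ≤ K := by
    have : (0:ℝ) ≤ m := by positivity
    rw [hK]; nlinarith
  refine ⟨C * K ^ p, by positivity, fun u hu => ?_⟩
  have hmu := meas_u hα hu
  have hmdu := meas_du hα hu
  have hmt : Measurable (fun z : Fin (m+1) → ℝ => z (Fin.last m)) := measurable_pi_apply _
  have hma : Measurable (fun z => |u (strE m α z)|) := continuous_abs.measurable.comp hmu
  have e2 : enD m α p u = ∫⁻ z in cubeQ (m+1), ENNReal.ofReal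
      ((‖fderiv ℝ u (strE m α z)‖ ^ p + |u (strE m α z)| ^ p) * z (Fin.last m) ^ (α * m)) := by
    rw [enD, ← lintegral_add_left (by fun_prop)]
    apply setLIntegral_congr_fun (cubeQ_meas _)
    intro z hz
    have := (mem_cubeQ.1 hz (Fin.last m)).1
    simp only
    rw [← ENNReal.ofReal_mul (by positivity), ← ENNReal.ofReal_mul (by positivity),
      ← ENNReal.ofReal_add (by positivity) (by positivity)]
    congr 1; ring
  rw [e2, aux_fub (Fin.last m) (by exact ((hma.pow_const _).mul (hmt.pow_const _)).ennreal_ofReal),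
    aux_fub (Fin.last m) (by exact (((hmdu.pow_const _).add (hma.pow_const _)).mul (hmt.pow_const _)).ennreal_ofReal),
    ← lintegral_const_mul' _ _ ENNReal.ofReal_ne_top]
  apply setLIntegral_mono' (cubeQ_meas _)
  intro y hy
  have hv := strE_line hα hu ((Fin.last m).insertNth (0:ℝ) y) (Fin.last m)
  have h1 := hardy _ hv
  simp only [← aux_insert_eq_update] at h1
  simp only [Fin.insertNth_apply_same]
  rw [show α * m - p + 1 - 1 = α * m - p by ring, show α * m - p + p = α * m by ring] at h1
  refine h1.trans ?_
  rw [ENNReal.ofReal_mul hC.le, mul_assoc]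
  gcongr
  rw [← lintegral_const_mul' _ _ ENNReal.ofReal_ne_top]
  apply setLIntegral_mono' measurableSet_Ioo
  intro s hs
  have hs0 := hs.1
  rw [← ENNReal.ofReal_mul (by positivity)]
  apply ENNReal.ofReal_le_ofReal
  have hd := strE_line_deriv hα hu ((Fin.last m).insertNth (0:ℝ) y) (Fin.last m) s
  simp only [← aux_insert_eq_update] at hd
  have hd2 := strD_norm_last hα ((Fin.last m).insertNth s y : Fin (m+1) → ℝ)
    (aux_insert_mem _ hy ⟨hs.1.le, hs.2.le⟩)
  rw [← mul_assoc]
  gcongr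
  rw [mul_add]
  have k1 : 1 ≤ K ^ p := Real.one_le_rpow hK1 (by linarith)
  apply add_le_add
  · rw [← Real.mul_rpow (by positivity) (by positivity)]
    gcongr
    rw [mul_comm]
    exact hd.trans (by gcongr)
  · exact le_mul_of_one_le_left (by positivity) k1

lemma interior_bound {m : ℕ} {α p : ℝ} (hm : 1 ≤ m) (hα : 1 ≤ α) (hp : 1 < p) (hpm : p < m + 1)
    {q b : ℝ} (hqdef : q = p * m / (m + 1 - p)) (hbdef : b = m * (α * m + 1 - p) / (m + 1 - p))
    (hq : 1 < q) (hb : 1 ≤ b) :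
    ∃ C : ℝ, 0 < C ∧ ∀ u : EuclideanSpace ℝ (Fin (m+1)) → ℝ, ContDiff ℝ 1 u →
    ∫⁻ z in cubeQ (m+1), ENNReal.ofReal (trF m α q b u z) ≤
      ENNReal.ofReal C * enD m α p u ^ (q / p) := by
  have hm0 : (0:ℝ) < m := by exact_mod_cast hm
  have hp0 : 0 < p := by linarith
  have hnp : 0 < (m:ℝ) + 1 - p := by linarith
  obtain ⟨C1, hC1, hardy⟩ := hardy_cube hα hp hpm
  obtain ⟨C2, hC2, sob⟩ := sobolev hm hα hq hb
  have hpq : p.HolderConjugate (p / (p - 1)) := Real.HolderConjugate.conjExponent hp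
  set p' := p / (p - 1) with hp'
  have hp'0 : 0 < p' := hpq.symm.pos
  have hp1 : p - 1 ≠ 0 := by linarith
  have ex1 : (q - 1) * p' = q + q / m := by
    rw [hqdef, hp']; field_simp; ring
  have ex2 : (b - α * m / p) * p' = b - 1 + b / m := by
    rw [hbdef, hp']; field_simp; ring
  have ex3 : 1 - ((m:ℝ) + 1) / m * (1 / p') = 1 / q := by
    rw [hqdef, hp']; field_simp; ring
  set C3 : ℝ := 2 ^ p * (1 + C1) with hC3
  have hC3p : 0 < C3 := by positivity
  refine ⟨((C3 ^ (1/p)) * (C2 ^ (1/p'))) ^ q, by positivity, fun u hu => ?_⟩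
  set D := enD m α p u with hD
  set I := ∫⁻ z in cubeQ (m+1), ENNReal.ofReal (trF m α q b u z) with hI
  have hmu := meas_u hα hu
  have hmdu := meas_du hα hu
  have hmt : Measurable (fun z : Fin (m+1) → ℝ => z (Fin.last m)) := measurable_pi_apply _
  have hma : Measurable (fun z => |u (strE m α z)|) := continuous_abs.measurable.comp hmu
  have hH := ENNReal.lintegral_mul_le_Lp_mul_Lq (volume.restrict (cubeQ (m+1))) hpq
      (f := fun z => ENNReal.ofReal (z (Fin.last m) ^ (α * m / p) * (‖fderiv ℝ u (strE m α z)‖ + |u (strE m α z)| * (z (Fin.last m))⁻¹)))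
      (g := fun z => ENNReal.ofReal (|u (strE m α z)| ^ (q - 1) * z (Fin.last m) ^ (b - α * m / p)))
      ((hmt.pow_const _).mul (hmdu.add (hma.mul hmt.inv))).ennreal_ofReal.aemeasurable
      ((hma.pow_const _).mul (hmt.pow_const _)).ennreal_ofReal.aemeasurable
  have hE : I = ∫⁻ z in cubeQ (m+1), ((fun z => ENNReal.ofReal (z (Fin.last m) ^ (α * m / p) * (‖fderiv ℝ u (strE m α z)‖ + |u (strE m α z)| * (z (Fin.last m))⁻¹))) *
      (fun z => ENNReal.ofReal (|u (strE m α z)| ^ (q - 1) * z (Fin.last m) ^ (b - α * m / p)))) z := by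
    apply setLIntegral_congr_fun (cubeQ_meas _)
    intro z hz
    have ht0 := (mem_cubeQ.1 hz (Fin.last m)).1
    simp only [Pi.mul_apply]
    rw [← ENNReal.ofReal_mul (by positivity)]
    congr 1
    unfold trF
    set t := z (Fin.last m)
    set A := |u (strE m α z)|
    have hA : 0 ≤ A := abs_nonneg _
    have e1 : t ^ b = t ^ (α * m / p) * t ^ (b - α * m / p) := by
      rw [← Real.rpow_add ht0]; congr 1; ring
    have e2 : t ^ (b - 1) = t ^ b * t⁻¹ := by rw [Real.rpow_sub_one ht0.ne', div_eq_mul_inv]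
    have e3 : A ^ q = A ^ (q - 1) * A := by
      rw [← Real.rpow_add_one' hA (by linarith)]; congr 1; ring
    rw [e2, e3, e1]; ring
  have hF : ∫⁻ z in cubeQ (m+1), (fun z => ENNReal.ofReal (z (Fin.last m) ^ (α * m / p) * (‖fderiv ℝ u (strE m α z)‖ + |u (strE m α z)| * (z (Fin.last m))⁻¹))) z ^ p
      ≤ ENNReal.ofReal C3 * D := by
    have k : ∀ z ∈ cubeQ (m+1), (fun z => ENNReal.ofReal (z (Fin.last m) ^ (α * m / p) * (‖fderiv ℝ u (strE m α z)‖ + |u (strE m α z)| * (z (Fin.last m))⁻¹))) z ^ p ≤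
       ENNReal.ofReal (2 ^ p) * (ENNReal.ofReal (z (Fin.last m) ^ (α * m)) * ENNReal.ofReal (‖fderiv ℝ u (strE m α z)‖ ^ p) + ENNReal.ofReal (|u (strE m α z)| ^ p * z (Fin.last m) ^ (α * m - p))) := by
      intro z hz
      have ht0 := (mem_cubeQ.1 hz (Fin.last m)).1
      simp only
      rw [ENNReal.ofReal_rpow_of_nonneg (by positivity) hp0.le, ← ENNReal.ofReal_mul (by positivity),
        ← ENNReal.ofReal_add (by positivity) (by positivity), ← ENNReal.ofReal_mul (by positivity)]
      apply ENNReal.ofReal_le_ofReal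
      set t := z (Fin.last m)
      set A := |u (strE m α z)|
      set G := ‖fderiv ℝ u (strE m α z)‖
      have hA : 0 ≤ A := abs_nonneg _
      have hG : 0 ≤ G := norm_nonneg _
      rw [Real.mul_rpow (by positivity) (by positivity), ← Real.rpow_mul ht0.le, div_mul_cancel₀ _ hp0.ne']
      calc t ^ (α * m) * (G + A * t⁻¹) ^ p ≤ t ^ (α * m) * (2 ^ p * (G ^ p + (A * t⁻¹) ^ p)) := by
            gcongr
            exact aux_add_rpow hG (by positivity) hp0.le
        _ = _ := by
          rw [Real.mul_rpow hA (by positivity), Real.rpow_sub ht0, Real.inv_rpow ht0.le]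
          ring
    refine (setLIntegral_mono' (cubeQ_meas _) k).trans ?_
    rw [lintegral_const_mul' _ _ ENNReal.ofReal_ne_top, lintegral_add_left (by fun_prop), hC3,
      ENNReal.ofReal_mul (by positivity), mul_assoc]
    gcongr
    rw [ENNReal.ofReal_add (by positivity) hC1.le, ENNReal.ofReal_one, add_mul, one_mul]
    exact add_le_add le_self_add (hardy u hu)
  have hG : ∫⁻ z in cubeQ (m+1), (fun z => ENNReal.ofReal (|u (strE m α z)| ^ (q - 1) * z (Fin.last m) ^ (b - α * m / p))) z ^ p'
      ≤ ENNReal.ofReal C2 * I ^ (((m:ℝ) + 1) / m) := by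
    refine le_trans (le_of_eq ?_) (sob u hu)
    apply setLIntegral_congr_fun (cubeQ_meas _)
    intro z hz
    have ht0 := (mem_cubeQ.1 hz (Fin.last m)).1
    simp only
    rw [ENNReal.ofReal_rpow_of_nonneg (by positivity) hp'0.le, Real.mul_rpow (by positivity) (by positivity),
      ← Real.rpow_mul (abs_nonneg _), ← Real.rpow_mul ht0.le, ex1, ex2]
  rw [← hE] at hH
  have hmain : I ≤ (ENNReal.ofReal (C3 ^ (1/p) * C2 ^ (1/p')) * D ^ (1/p)) * I ^ (((m:ℝ) + 1) / m * (1 / p')) := by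
    refine hH.trans ?_
    calc _ ≤ (ENNReal.ofReal C3 * D) ^ (1/p) * (ENNReal.ofReal C2 * I ^ (((m:ℝ) + 1) / m)) ^ (1/p') := by
          gcongr
      _ = _ := by
        rw [ENNReal.mul_rpow_of_nonneg _ _ (by positivity), ENNReal.mul_rpow_of_nonneg _ _ (by positivity),
          ← ENNReal.rpow_mul, ENNReal.ofReal_rpow_of_pos hC3p, ENNReal.ofReal_rpow_of_pos hC2,
          ENNReal.ofReal_mul (by positivity)]
        ring
  have := aux_absorb hmain (trF_fin hα hq hb hu) (by
    have : 0 < 1 / q := by positivity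
    linarith)
  rw [ex3, one_div_one_div, ENNReal.mul_rpow_of_nonneg _ _ (by linarith), ← ENNReal.rpow_mul,
    ENNReal.ofReal_rpow_of_pos (by positivity), one_div_mul_eq_div] at this
  exact this

lemma lip_param {m : ℕ} (f : (Fin m → ℝ) → EuclideanSpace ℝ (Fin (m+1))) (hf : Measurable f)
    {K : NNReal} {s : Set (Fin m → ℝ)} (h : LipschitzOnWith K f s)
    (g : EuclideanSpace ℝ (Fin (m+1)) → ℝ≥0∞) (hg : Measurable g) :
    ∫⁻ x in f '' s, g x ∂(μH[(m:ℝ)]) ≤ (K : ℝ≥0∞) ^ (m:ℝ) * ∫⁻ y in s, g (f y) := by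
  have hv : (volume : Measure (Fin m → ℝ)) = μH[(m:ℝ)] := by
    rw [← hausdorffMeasure_pi_real (ι := Fin m)]; simp
  have hle : (μH[(m:ℝ)] : Measure (EuclideanSpace ℝ (Fin (m+1)))).restrict (f '' s) ≤
      ((K : ℝ≥0∞) ^ (m:ℝ)) • (Measure.map f (volume.restrict s)) := by
    rw [Measure.le_iff]
    intro A hA
    rw [Measure.restrict_apply hA, Measure.smul_apply, Measure.map_apply hf hA,
      Measure.restrict_apply (hf hA), hv, smul_eq_mul, Set.inter_comm, ← Set.image_inter_preimage,
      Set.inter_comm]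
    exact (h.mono Set.inter_subset_right).hausdorffMeasure_image_le (by positivity)
  calc _ ≤ ∫⁻ x, g x ∂(((K : ℝ≥0∞) ^ (m:ℝ)) • (Measure.map f (volume.restrict s))) :=
        lintegral_mono' hle le_rfl
    _ = _ := by rw [lintegral_smul_measure, lintegral_map hg hf, smul_eq_mul]

/-- graph parametrisation of a face -/
def facP {m : ℕ} (i : Fin (m+1)) (c : (Fin m → ℝ) → ℝ) (y : Fin m → ℝ) : EuclideanSpace ℝ (Fin (m+1)) :=
  WithLp.toLp 2 (i.insertNth (c y) y : Fin (m+1) → ℝ)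

lemma facP_meas {m : ℕ} (i : Fin (m+1)) {c : (Fin m → ℝ) → ℝ} (hc : Measurable c) :
    Measurable (facP i c) := by
  refine (WithLp.measurable_toLp 2 _).comp ?_
  rw [measurable_pi_iff]
  intro j
  by_cases hj : j = i
  · subst hj; simpa using hc
  · obtain ⟨k, rfl⟩ := Fin.exists_succAbove_eq hj
    simpa using measurable_pi_apply k

lemma facP_lip {m : ℕ} (i : Fin (m+1)) {c : (Fin m → ℝ) → ℝ} {K : NNReal} {s : Set (Fin m → ℝ)}
    (hc : LipschitzOnWith K c s) : ∃ K' : NNReal, LipschitzOnWith K' (facP i c) s := by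
  have h1 : LipschitzOnWith (max 1 K) (fun y => (i.insertNth (c y) y : Fin (m+1) → ℝ)) s := by
    intro x hx y hy
    rw [edist_pi_le_iff]
    intro j
    by_cases hj : j = i
    · subst hj
      simp only [Fin.insertNth_apply_same]
      refine (hc hx hy).trans ?_
      gcongr
      exact le_max_right _ _
    · obtain ⟨k, rfl⟩ := Fin.exists_succAbove_eq hj
      simp only [Fin.insertNth_apply_succAbove]
      refine (edist_le_pi_edist x y k).trans ?_
      refine le_mul_of_one_le_left (zero_le) ?_
      exact_mod_cast le_max_left _ _
  exact ⟨_, (PiLp.lipschitzWith_toLp 2 (fun _ : Fin (m+1) => ℝ)).comp_lipschitzOnWith h1⟩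

lemma face_bound {m : ℕ} (i : Fin (m+1)) {c : (Fin m → ℝ) → ℝ} (hcm : Measurable c) {K : NNReal} {s : Set (Fin m → ℝ)}
    (hc : LipschitzOnWith K c s) : ∃ C : ℝ, 0 < C ∧ ∀ g : EuclideanSpace ℝ (Fin (m+1)) → ℝ≥0∞, Measurable g →
    ∫⁻ x in facP i c '' s, g x ∂(μH[(m:ℝ)]) ≤ ENNReal.ofReal C * ∫⁻ y in s, g (facP i c y) := by
  obtain ⟨K', h⟩ := facP_lip i hc
  refine ⟨(K' : ℝ) ^ (m:ℝ) + 1, by positivity, fun g hg => ?_⟩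
  refine (lip_param _ (facP_meas i hcm) h g hg).trans ?_
  gcongr
  rw [← ENNReal.ofReal_coe_nnreal, ENNReal.ofReal_rpow_of_nonneg (by positivity) (by positivity)]
  exact ENNReal.ofReal_le_ofReal (by linarith)

lemma pow_lip {α : ℝ} (hα : 1 ≤ α) : LipschitzOnWith α.toNNReal (fun x : ℝ => x ^ α) (Set.Icc 0 1) := by
  refine (convex_Icc (0:ℝ) 1).lipschitzOnWith_of_nnnorm_deriv_le
    (fun x _ => (Real.hasDerivAt_rpow_const (Or.inr hα)).differentiableAt) ?_
  intro x hx
  rw [(Real.hasDerivAt_rpow_const (Or.inr hα)).deriv, ← NNReal.coe_le_coe, coe_nnnorm,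
    Real.coe_toNNReal _ (by linarith), Real.norm_eq_abs, abs_of_nonneg]
  · have := Real.rpow_le_one hx.1 hx.2 (by linarith : 0 ≤ α - 1)
    nlinarith
  · have := Real.rpow_nonneg hx.1 (α - 1)
    positivity

/-- base of the lateral faces -/
def latS {m : ℕ} (α : ℝ) (j : Fin m) : Set (Fin m → ℝ) :=
  {y | (∀ k, 0 ≤ y k ∧ y k ≤ 1) ∧ ∀ k, k ≠ j → y k ≤ y j ^ α}

lemma latS_meas {m : ℕ} (α : ℝ) (j : Fin m) : MeasurableSet (latS α j) := by
  have : latS α j = (⋂ k, {y | 0 ≤ y k ∧ y k ≤ 1}) ∩ ⋂ k, {y | k ≠ j → y k ≤ y j ^ α} := by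
    ext y; simp [latS]
  rw [this]
  refine MeasurableSet.inter (MeasurableSet.iInter fun k => ?_) (MeasurableSet.iInter fun k => ?_)
  · exact (measurableSet_le measurable_const (measurable_pi_apply k)).inter
      (measurableSet_le (measurable_pi_apply k) measurable_const)
  · by_cases h : k = j
    · simp [h]
    · simp only [ne_eq, h, not_false_eq_true, true_imp_iff]
      exact measurableSet_le (measurable_pi_apply k) ((measurable_pi_apply j).pow_const α)

lemma ins_line {m : ℕ} (i : Fin (m+1)) (y : Fin m → ℝ) (s : ℝ) :
    HasDerivAt (fun s => (WithLp.toLp 2 (i.insertNth s y : Fin (m+1) → ℝ) : EuclideanSpace ℝ (Fin (m+1))))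
      (EuclideanSpace.single i 1) s := by
  have : (fun s => (WithLp.toLp 2 (i.insertNth s y : Fin (m+1) → ℝ) : EuclideanSpace ℝ (Fin (m+1)))) =
     fun s => (WithLp.toLp 2 (i.insertNth (0:ℝ) y : Fin (m+1) → ℝ) : EuclideanSpace ℝ (Fin (m+1))) + s • EuclideanSpace.single i (1:ℝ) := by
    funext s
    ext j
    by_cases hj : j = i
    · subst hj; simp
    · obtain ⟨k, rfl⟩ := Fin.exists_succAbove_eq hj
      simp
  rw [this]
  have h := ((hasDerivAt_id s).smul_const (EuclideanSpace.single i (1:ℝ))).const_add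
    (WithLp.toLp 2 (i.insertNth (0:ℝ) y : Fin (m+1) → ℝ) : EuclideanSpace ℝ (Fin (m+1)))
  rw [one_smul] at h
  exact h

lemma ins_contDiff {m : ℕ} (i : Fin (m+1)) (y : Fin m → ℝ) :
    ContDiff ℝ 1 (fun s => (WithLp.toLp 2 (i.insertNth s y : Fin (m+1) → ℝ) : EuclideanSpace ℝ (Fin (m+1)))) := by
  rw [contDiff_one_iff_deriv]
  refine ⟨fun s => (ins_line i y s).differentiableAt, ?_⟩
  rw [funext fun s => (ins_line i y s).deriv]
  exact continuous_const

lemma ins_deriv {m : ℕ} (i : Fin (m+1)) (y : Fin m → ℝ) (s : ℝ) {u : EuclideanSpace ℝ (Fin (m+1)) → ℝ}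
    (hu : ContDiff ℝ 1 u) :
    |deriv (fun s => u (WithLp.toLp 2 (i.insertNth s y : Fin (m+1) → ℝ))) s| ≤
      ‖fderiv ℝ u (WithLp.toLp 2 (i.insertNth s y : Fin (m+1) → ℝ))‖ := by
  have h := ((hu.differentiable one_ne_zero) (WithLp.toLp 2 (i.insertNth s y : Fin (m+1) → ℝ))).hasFDerivAt.comp_hasDerivAt s (ins_line i y s)
  have h2 := h.deriv
  simp only [Function.comp_def] at h2
  rw [h2, ← Real.norm_eq_abs]
  refine (ContinuousLinearMap.le_opNorm _ _).trans ?_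
  simp

lemma lat_int {m : ℕ} {α q β b : ℝ} (hα : 1 ≤ α) (hq : 1 < q) (hβ : 0 < β)
    (hb : b = β + α * (m - 1) + 1) {i : Fin (m+1)} {j : Fin m} (hj : i.succAbove j = Fin.last m)
    {c : (Fin m → ℝ) → ℝ} (hc : ∀ y ∈ latS α j, 0 ≤ c y ∧ c y ≤ y j ^ α)
    {u : EuclideanSpace ℝ (Fin (m+1)) → ℝ} (hu : ContDiff ℝ 1 u) :
    ∫⁻ y in latS α j, ENNReal.ofReal (|u (facP i c y)| ^ q * (facP i c y) (Fin.last m) ^ β) ≤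
      ENNReal.ofReal (q + 1) * ∫⁻ z in cubeQ (m+1), ENNReal.ofReal (trF m α q b u z) := by
  set f : (Fin (m+1) → ℝ) → ℝ≥0∞ := fun x => ENNReal.ofReal
    (x (Fin.last m) ^ (β - α) * |u (WithLp.toLp 2 x)| ^ q +
      q * x (Fin.last m) ^ β * |u (WithLp.toLp 2 x)| ^ (q - 1) * ‖fderiv ℝ u (WithLp.toLp 2 x)‖) with hf
  have hcu : Continuous (fun x : Fin (m+1) → ℝ => u (WithLp.toLp 2 x)) :=
    hu.continuous.comp (PiLp.continuous_toLp 2 _)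
  have hcd : Continuous (fun x : Fin (m+1) → ℝ => ‖fderiv ℝ u (WithLp.toLp 2 x)‖) :=
    ((hu.continuous_fderiv one_ne_zero).comp (PiLp.continuous_toLp 2 _)).norm
  have hma : Measurable (fun x : Fin (m+1) → ℝ => |u (WithLp.toLp 2 x)|) := hcu.abs.measurable
  have hmt : Measurable (fun z : Fin (m+1) → ℝ => z (Fin.last m)) := measurable_pi_apply _
  have hfm : Measurable f :=
    (((hmt.pow_const _).mul (hma.pow_const _)).add
      (((measurable_const.mul (hmt.pow_const _)).mul (hma.pow_const _)).mul hcd.measurable)).ennreal_ofReal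
  have hcm : MeasurableSet (cuspH m α) := by
    have : cuspH m α = {x | 0 < x (Fin.last m)} ∩ ({x | x (Fin.last m) ≤ 1} ∩
        ⋂ i, {x | i ≠ Fin.last m → 0 ≤ x i ∧ x i ≤ x (Fin.last m) ^ α}) := by
      ext x; simp [cuspH]
    rw [this]
    refine (measurableSet_lt measurable_const hmt).inter ((measurableSet_le hmt measurable_const).inter
      (MeasurableSet.iInter fun k => ?_))
    by_cases h : k = Fin.last m
    · simp [h]
    · simp only [ne_eq, h, not_false_eq_true, true_imp_iff]
      exact (measurableSet_le measurable_const (measurable_pi_apply k)).inter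
        (measurableSet_le (measurable_pi_apply k) (hmt.pow_const α))
  have hlast : ∀ (s : ℝ) (y : Fin m → ℝ), (i.insertNth s y : Fin (m+1) → ℝ) (Fin.last m) = y j := by
    intro s y; rw [← hj, Fin.insertNth_apply_succAbove]
  have step1 : ∀ y ∈ latS α j, ENNReal.ofReal (|u (facP i c y)| ^ q * (facP i c y) (Fin.last m) ^ β) ≤
      ∫⁻ s, (cuspH m α).indicator f (i.insertNth s y) := by
    intro y hy
    have hl : (facP i c y) (Fin.last m) = y j := hlast _ _
    rw [hl]
    rcases (hy.1 j).1.eq_or_lt with h0 | h0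
    · rw [← h0, Real.zero_rpow hβ.ne']; simp
    set t := y j with ht
    have hL : 0 < t ^ α := by positivity
    have hA := aux_lineA (hu.comp (ins_contDiff i y)) hq hL (x := c y) (hc y hy)
    have e0 : ENNReal.ofReal (|u (facP i c y)| ^ q * t ^ β) = ENNReal.ofReal (t ^ β) *
        ENNReal.ofReal (|(u ∘ fun s => (WithLp.toLp 2 (i.insertNth s y : Fin (m+1) → ℝ))) (c y)| ^ q) := by
      rw [← ENNReal.ofReal_mul (by positivity), mul_comm]; rfl
    rw [e0]
    refine (mul_le_mul_right hA _).trans ?_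
    rw [← lintegral_const_mul' _ _ ENNReal.ofReal_ne_top, ← lintegral_indicator measurableSet_Ioo]
    apply lintegral_mono
    intro s
    by_cases hs : s ∈ Set.Ioo 0 (t ^ α)
    · have hmem : (i.insertNth s y : Fin (m+1) → ℝ) ∈ cuspH m α := by
        refine ⟨?_, ?_, ?_⟩
        · rw [hlast]; exact h0
        · rw [hlast]; exact (hy.1 j).2
        · intro k hk
          rw [hlast]
          by_cases hki : k = i
          · subst hki; simpa using ⟨hs.1.le, hs.2.le⟩
          · obtain ⟨l, rfl⟩ := Fin.exists_succAbove_eq hki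
            rw [Fin.insertNth_apply_succAbove]
            refine ⟨(hy.1 l).1, hy.2 l ?_⟩
            rintro rfl; exact hk hj
      simp only [Set.indicator_of_mem hs, Set.indicator_of_mem hmem, hf, hlast]
      rw [← ENNReal.ofReal_mul (by positivity)]
      apply ENNReal.ofReal_le_ofReal
      have hd := ins_deriv i y s hu
      simp only [Function.comp_def]
      rw [mul_add, Real.rpow_sub h0]
      apply add_le_add
      · rw [← mul_assoc, div_eq_mul_inv]
      · calc _ ≤ t ^ β * (q * |u (WithLp.toLp 2 (i.insertNth s y))| ^ (q - 1) * ‖fderiv ℝ u (WithLp.toLp 2 (i.insertNth s y : Fin (m+1) → ℝ))‖) := by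
              gcongr
          _ = _ := by ring
    · simp [Set.indicator_of_notMem hs]
  calc _ ≤ ∫⁻ y in latS α j, ∫⁻ s, (cuspH m α).indicator f (i.insertNth s y) :=
        setLIntegral_mono' (latS_meas α j) step1
    _ ≤ ∫⁻ y, ∫⁻ s, (cuspH m α).indicator f (i.insertNth s y) := setLIntegral_le_lintegral _ _
    _ = ∫⁻ x, (cuspH m α).indicator f x := by
      have h' := (volume_preserving_piFinSuccAbove (fun _ : Fin (m+1) => ℝ) i).symm
      rw [← h'.lintegral_comp (hfm.indicator hcm), Measure.volume_eq_prod, lintegral_prod_symm]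
      · rfl
      · exact ((hfm.indicator hcm).comp (MeasurableEquiv.measurable _)).aemeasurable
    _ = ∫⁻ x in cuspH m α, f x := lintegral_indicator hcm _
    _ = _ := cov_half hα f
    _ ≤ ∫⁻ z in cubeQ (m+1), ENNReal.ofReal (q + 1) * ENNReal.ofReal (trF m α q b u z) := by
      apply setLIntegral_mono' (cubeQ_meas _)
      intro z hz
      have ht0 := (mem_cubeQ.1 hz (Fin.last m)).1
      have ht1 := (mem_cubeQ.1 hz (Fin.last m)).2.le
      simp only [hf, strFun_last]
      rw [← ENNReal.ofReal_mul (by positivity), ← ENNReal.ofReal_mul (by positivity)]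
      apply ENNReal.ofReal_le_ofReal
      change _ * (_ * |u (strE m α z)| ^ q + q * _ * |u (strE m α z)| ^ (q - 1) * ‖fderiv ℝ u (strE m α z)‖) ≤ _
      unfold trF
      set t := z (Fin.last m)
      set A := |u (strE m α z)|
      set G := ‖fderiv ℝ u (strE m α z)‖
      have hA : 0 ≤ A := abs_nonneg _
      have hG : 0 ≤ G := norm_nonneg _
      have e1 : t ^ (α * m) * t ^ (β - α) = t ^ (b - 1) := by
        rw [← Real.rpow_add ht0, hb]; congr 1; ring
      have e2 : t ^ (α * m) * t ^ β ≤ t ^ b := by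
        rw [← Real.rpow_add ht0, hb]
        apply Real.rpow_le_rpow_of_exponent_ge ht0 ht1
        linarith
      calc _ = (t ^ (α * m) * t ^ (β - α)) * A ^ q + q * (t ^ (α * m) * t ^ β) * A ^ (q-1) * G := by ring
        _ ≤ t ^ (b - 1) * A ^ q + q * t ^ b * A ^ (q-1) * G := by rw [e1]; gcongr
        _ ≤ _ := by
          have k1 : 0 ≤ t ^ (b - 1) * A ^ q := by positivity
          have k2 : 0 ≤ t ^ b * A ^ (q-1) * G := by positivity
          nlinarith
    _ = _ := lintegral_const_mul' _ _ ENNReal.ofReal_ne_top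

lemma top_int {m : ℕ} {α q β b : ℝ} (hα : 1 ≤ α) (hq : 1 < q) (hb : 1 ≤ b)
    {u : EuclideanSpace ℝ (Fin (m+1)) → ℝ} (hu : ContDiff ℝ 1 u) :
    ∫⁻ y in Set.Icc (fun _ => (0:ℝ)) (fun _ => 1), ENNReal.ofReal (|u (facP (Fin.last m) (fun _ => 1) y)| ^ q *
        (facP (Fin.last m) (fun _ => 1) y) (Fin.last m) ^ β) ≤
      ENNReal.ofReal (q * ((m + 1) * α) + b) * ∫⁻ z in cubeQ (m+1), ENNReal.ofReal (trF m α q b u z) := by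
  rw [← setLIntegral_congr (cubeQ_ae m), aux_fub (Fin.last m) (trF_cont hα hq hb hu).measurable.ennreal_ofReal,
    ← lintegral_const_mul' _ _ ENNReal.ofReal_ne_top]
  apply setLIntegral_mono' (cubeQ_meas _)
  intro y hy
  have h := gridB hα hq hb hu (z := (Fin.last m).insertNth (1:ℝ) y) (aux_insert_mem _ hy ⟨zero_le_one, le_rfl⟩)
  have e : strE m α ((Fin.last m).insertNth (1:ℝ) y) = facP (Fin.last m) (fun _ => 1) y := by
    unfold strE facP
    congr 1
    funext k
    by_cases hk : k = Fin.last m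
    · subst hk; rw [strFun_last]
    · rw [strFun_ne _ hk]; simp
  have e2 : (facP (Fin.last m) (fun _ => 1) y) (Fin.last m) = 1 := by
    show ((Fin.last m).insertNth (1:ℝ) y : Fin (m+1) → ℝ) (Fin.last m) = 1
    simp
  rw [e] at h
  rw [e2]
  simp only [Fin.insertNth_apply_same, Real.one_rpow, Fin.update_insertNth] at h ⊢
  exact h

lemma isOpen_S {m : ℕ} {α : ℝ} (hα : 1 ≤ α) (S : Set (EuclideanSpace ℝ (Fin (m+1))))
    (hS : ∀ x, x ∈ S ↔ 0 < x (Fin.last m) ∧ x (Fin.last m) < 1 ∧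
      ∀ i, i ≠ Fin.last m → 0 < x i ∧ x i < x (Fin.last m) ^ α) : IsOpen S := by
  have hc : ∀ i, Continuous (fun x : EuclideanSpace ℝ (Fin (m+1)) => x i) := fun i => by fun_prop
  have : S = {x | 0 < x (Fin.last m)} ∩ ({x | x (Fin.last m) < 1} ∩
        ⋂ i, {x | i ≠ Fin.last m → 0 < x i ∧ x i < x (Fin.last m) ^ α}) := by
    ext x; simp [hS]
  rw [this]
  refine (isOpen_lt continuous_const (hc _)).inter ((isOpen_lt (hc _) continuous_const).inter
      (isOpen_iInter_of_finite fun k => ?_))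
  by_cases h : k = Fin.last m
  · simp [h]
  · simp only [ne_eq, h, not_false_eq_true, true_imp_iff]
    exact (isOpen_lt continuous_const (hc k)).inter
        (isOpen_lt (hc k) ((hc _).rpow_const fun _ => Or.inr (by linarith)))

lemma closure_S {m : ℕ} {α : ℝ} (hα : 1 ≤ α) (S : Set (EuclideanSpace ℝ (Fin (m+1))))
    (hS : ∀ x, x ∈ S ↔ 0 < x (Fin.last m) ∧ x (Fin.last m) < 1 ∧
      ∀ i, i ≠ Fin.last m → 0 < x i ∧ x i < x (Fin.last m) ^ α) {x} (hx : x ∈ closure S) :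
    0 ≤ x (Fin.last m) ∧ x (Fin.last m) ≤ 1 ∧
      ∀ i, i ≠ Fin.last m → 0 ≤ x i ∧ x i ≤ x (Fin.last m) ^ α := by
  have hc : ∀ i, Continuous (fun x : EuclideanSpace ℝ (Fin (m+1)) => x i) := fun i => by fun_prop
  have hcl : IsClosed ({x : EuclideanSpace ℝ (Fin (m+1)) | 0 ≤ x (Fin.last m)} ∩ ({x | x (Fin.last m) ≤ 1} ∩
        ⋂ i, {x | i ≠ Fin.last m → 0 ≤ x i ∧ x i ≤ x (Fin.last m) ^ α})) := by
    refine (isClosed_le continuous_const (hc _)).inter ((isClosed_le (hc _) continuous_const).inter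
      (isClosed_iInter fun k => ?_))
    by_cases h : k = Fin.last m
    · simp [h]
    · simp only [ne_eq, h, not_false_eq_true, true_imp_iff]
      exact (isClosed_le continuous_const (hc k)).inter
        (isClosed_le (hc k) ((hc _).rpow_const fun _ => Or.inr (by linarith)))
  have := closure_minimal (fun x hx => ?_) hcl hx
  · simpa using this
  · have := (hS x).1 hx
    simp only [Set.mem_inter_iff, Set.mem_setOf_eq, Set.mem_iInter]
    exact ⟨this.1.le, this.2.1.le, fun i hi => ⟨(this.2.2 i hi).1.le, (this.2.2 i hi).2.le⟩⟩

lemma facP_remove {m : ℕ} (i : Fin (m+1)) (c : (Fin m → ℝ) → ℝ) (x : EuclideanSpace ℝ (Fin (m+1)))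
    (h : c (i.removeNth (fun k => x k)) = x i) : facP i c (i.removeNth (fun k => x k)) = x := by
  unfold facP
  rw [h]
  ext k
  by_cases hk : k = i
  · subst hk; simp
  · obtain ⟨l, rfl⟩ := Fin.exists_succAbove_eq hk
    simp [Fin.removeNth]

/-- index type of lateral faces -/
abbrev LatI (m : ℕ) := {x : Fin (m+1) × Fin m // x.1.succAbove x.2 = Fin.last m}

lemma frontier_sub {m : ℕ} (hm : 1 ≤ m) {α : ℝ} (hα : 1 ≤ α) (S : Set (EuclideanSpace ℝ (Fin (m+1))))
    (hS : ∀ x, x ∈ S ↔ 0 < x (Fin.last m) ∧ x (Fin.last m) < 1 ∧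
      ∀ i, i ≠ Fin.last m → 0 < x i ∧ x i < x (Fin.last m) ^ α) :
    frontier S ⊆ facP (Fin.last m) (fun _ => 1) '' Set.Icc (fun _ => (0:ℝ)) (fun _ => 1) ∪
      ⋃ a : LatI m, (facP a.1.1 (fun _ => 0) '' latS α a.1.2 ∪ facP a.1.1 (fun y => y a.1.2 ^ α) '' latS α a.1.2) := by
  intro x hx
  rw [(isOpen_S hα S hS).frontier_eq] at hx
  obtain ⟨h0, h1, h2⟩ := closure_S hα S hS hx.1
  have hle : ∀ k, 0 ≤ x k ∧ x k ≤ 1 := by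
    intro k
    by_cases hk : k = Fin.last m
    · subst hk; exact ⟨h0, h1⟩
    · exact ⟨(h2 k hk).1, (h2 k hk).2.trans (Real.rpow_le_one h0 h1 (by linarith))⟩
  have key : ∀ i, i ≠ Fin.last m → ∃ j : Fin m, i.succAbove j = Fin.last m ∧
      i.removeNth (fun k => x k) ∈ latS α j ∧ (i.removeNth (fun k => x k) : Fin m → ℝ) j = x (Fin.last m) := by
    intro i hi
    obtain ⟨j, hj⟩ := Fin.exists_succAbove_eq (Ne.symm hi)
    refine ⟨j, hj, ⟨fun k => hle _, fun k hk => ?_⟩, ?_⟩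
    · simp only [Fin.removeNth, hj]
      refine (h2 _ ?_).2
      rw [← hj]
      exact fun h => hk (Fin.succAbove_right_injective h)
    · simp only [Fin.removeNth, hj]
  by_cases ht1 : x (Fin.last m) = 1
  · left
    refine ⟨(Fin.last m).removeNth (fun k => x k), ⟨fun k => (hle _).1, fun k => (hle _).2⟩, ?_⟩
    exact facP_remove _ _ _ ht1.symm
  right
  rw [Set.mem_iUnion]
  by_cases hz : ∃ i, i ≠ Fin.last m ∧ x i = 0
  · obtain ⟨i, hi, hxi⟩ := hz
    obtain ⟨j, hj, hmem, hl⟩ := key i hi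
    exact ⟨⟨(i, j), hj⟩, Or.inl ⟨_, hmem, facP_remove _ _ _ hxi.symm⟩⟩
  by_cases hz2 : ∃ i, i ≠ Fin.last m ∧ x i = x (Fin.last m) ^ α
  · obtain ⟨i, hi, hxi⟩ := hz2
    obtain ⟨j, hj, hmem, hl⟩ := key i hi
    refine ⟨⟨(i, j), hj⟩, Or.inr ⟨_, hmem, facP_remove _ _ _ ?_⟩⟩
    simp only [hl, hxi]
  exfalso
  apply hx.2
  push Not at hz hz2
  rw [hS]
  refine ⟨lt_of_le_of_ne h0 ?_, lt_of_le_of_ne h1 ht1, fun i hi =>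
    ⟨lt_of_le_of_ne (h2 i hi).1 (hz i hi).symm, lt_of_le_of_ne (h2 i hi).2 (hz2 i hi)⟩⟩
  intro h
  have hne : (0 : Fin (m+1)) ≠ Fin.last m := by
    intro h'
    have := congrArg Fin.val h'
    simp at this
    omega
  have h3 := h2 0 hne
  rw [← h, Real.zero_rpow (by linarith)] at h3
  exact hz 0 hne (le_antisymm h3.2 h3.1)

lemma frontier_bound {m : ℕ} (hm : 1 ≤ m) {α : ℝ} (hα : 1 ≤ α) (S : Set (EuclideanSpace ℝ (Fin (m+1))))
    (hS : ∀ x, x ∈ S ↔ 0 < x (Fin.last m) ∧ x (Fin.last m) < 1 ∧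
      ∀ i, i ≠ Fin.last m → 0 < x i ∧ x i < x (Fin.last m) ^ α) :
    ∃ C : ℝ, 0 < C ∧ ∀ g : EuclideanSpace ℝ (Fin (m+1)) → ℝ≥0∞, Measurable g → ∀ X : ℝ≥0∞,
      (∫⁻ y in Set.Icc (fun _ => (0:ℝ)) (fun _ => 1), g (facP (Fin.last m) (fun _ => 1) y)) ≤ X →
      (∀ a : LatI m, ∫⁻ y in latS α a.1.2, g (facP a.1.1 (fun _ => 0) y) ≤ X) →
      (∀ a : LatI m, ∫⁻ y in latS α a.1.2, g (facP a.1.1 (fun y => y a.1.2 ^ α) y) ≤ X) →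
      ∫⁻ x in frontier S, g x ∂(μH[(m:ℝ)]) ≤ ENNReal.ofReal C * X := by
  obtain ⟨C0, hC0, H0⟩ := face_bound (s := Set.Icc (fun _ : Fin m => (0:ℝ)) (fun _ => 1)) (Fin.last m)
    (c := fun _ => 1) measurable_const (K := 0) (LipschitzWith.const _).lipschitzOnWith
  have hA : ∀ a : LatI m, _ := fun a => face_bound (s := latS α a.1.2) a.1.1
    (c := fun _ => 0) measurable_const (K := 0) (LipschitzWith.const _).lipschitzOnWith
  choose A hA0 HA using hA
  have hlip : ∀ a : LatI m, LipschitzOnWith (α.toNNReal * 1) (fun y : Fin m → ℝ => y a.1.2 ^ α) (latS α a.1.2) := by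
    intro a
    exact (pow_lip hα).comp (LipschitzWith.eval a.1.2).lipschitzOnWith (fun y hy => hy.1 a.1.2)
  have hB : ∀ a : LatI m, _ := fun a => face_bound (s := latS α a.1.2) a.1.1
    (c := fun y => y a.1.2 ^ α) ((measurable_pi_apply _).pow_const _) (hlip a)
  choose B hB0 HB using hB
  have hsum : 0 ≤ ∑ a, (A a + B a) := Finset.sum_nonneg fun a _ => (add_pos (hA0 a) (hB0 a)).le
  refine ⟨C0 + ∑ a, (A a + B a), by linarith, fun g hg X hX0 hXA hXB => ?_⟩
  refine (lintegral_mono_set (frontier_sub hm hα S hS)).trans ?_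
  refine (lintegral_union_le _ _ _).trans ?_
  rw [ENNReal.ofReal_add hC0.le hsum, add_mul]
  apply add_le_add
  · exact (H0 g hg).trans (by gcongr)
  · refine (lintegral_iUnion_le _ _).trans ?_
    rw [tsum_fintype, ENNReal.ofReal_sum_of_nonneg (fun a _ => (add_pos (hA0 a) (hB0 a)).le), Finset.sum_mul]
    apply Finset.sum_le_sum
    intro a _
    refine (lintegral_union_le _ _ _).trans ?_
    rw [ENNReal.ofReal_add (hA0 a).le (hB0 a).le, add_mul]
    apply add_le_add
    · refine (HA a g hg).trans ?_
      gcongr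
      exact hXA a
    · refine (HB a g hg).trans ?_
      gcongr
      exact hXB a

lemma trace_core {m : ℕ} (hm : 1 ≤ m) {α p q Q β b : ℝ} (hα : 1 ≤ α) (hp : 1 < p) (hpm : p < m + 1)
    (hq : 1 < q) (hqQ : q ≤ Q) (hQ : Q = p * m / (m + 1 - p)) (hβ : 0 < β)
    (hbdef : b = m * (α * m + 1 - p) / (m + 1 - p)) (hb : b = β + α * (m - 1) + 1)
    (S : Set (EuclideanSpace ℝ (Fin (m+1))))
    (hS : ∀ x, x ∈ S ↔ 0 < x (Fin.last m) ∧ x (Fin.last m) < 1 ∧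
      ∀ i, i ≠ Fin.last m → 0 < x i ∧ x i < x (Fin.last m) ^ α) :
    ∃ C : ℝ, 0 < C ∧ ∀ u : EuclideanSpace ℝ (Fin (m+1)) → ℝ, ContDiff ℝ 1 u →
      (∫⁻ x in frontier S, ENNReal.ofReal (|u x| ^ q * x (Fin.last m) ^ β) ∂(μH[(m:ℝ)])) ^ (1/q) ≤
      ENNReal.ofReal C * ((∫⁻ x in S, ENNReal.ofReal (‖fderiv ℝ u x‖ ^ p)) ^ (1/p) +
        (∫⁻ x in S, ENNReal.ofReal (|u x| ^ p)) ^ (1/p)) := by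
  have hm1 : (1:ℝ) ≤ m := by exact_mod_cast hm
  have hQ1 : 1 < Q := lt_of_lt_of_le hq hqQ
  have hQ0 : 0 < Q := by linarith
  have hb1 : 1 ≤ b := by
    have : 0 ≤ α * (m - 1) := mul_nonneg (by linarith) (by linarith)
    linarith
  obtain ⟨C1, hC1, H1⟩ := frontier_bound hm hα S hS
  obtain ⟨C2, hC2, H2⟩ := interior_bound hm hα hp hpm hQ hbdef hQ1 hb1
  have hmt : Measurable (fun x : EuclideanSpace ℝ (Fin (m+1)) => x (Fin.last m)) :=
    Continuous.measurable (by fun_prop)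
  have hM : μH[(m:ℝ)] (frontier S) ≤ ENNReal.ofReal C1 := by
    have hv : volume (Set.Icc (fun _ : Fin m => (0:ℝ)) (fun _ => 1)) = 1 := by
      rw [Real.volume_Icc_pi]; simp
    have hl : ∀ j : Fin m, volume (latS α j) ≤ 1 := by
      intro j
      rw [← hv]
      exact measure_mono fun y hy => ⟨fun k => (hy.1 k).1, fun k => (hy.1 k).2⟩
    have := H1 (fun _ => 1) measurable_const 1 (by simp [hv]) (fun a => by simpa using hl _)
      (fun a => by simpa using hl _)
    simpa using this
  set k : ℝ := (Q + 1) + (Q * ((m + 1) * α) + b) with hk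
  have hk1 : 0 ≤ Q * ((m + 1) * α) + b := by positivity
  have hk0 : 0 < k := by rw [hk]; linarith
  set e : ℝ := 1 / q - 1 / Q with he
  have he0 : 0 ≤ e := by
    rw [he, sub_nonneg]; exact one_div_le_one_div_of_le (by linarith) hqQ
  refine ⟨(C1 * (k * C2)) ^ (1/Q) * C1 ^ e, by positivity, fun u hu => ?_⟩
  have hmu : Measurable (fun x => |u x|) := hu.continuous.abs.measurable
  have hJ : ∫⁻ x in frontier S, ENNReal.ofReal (|u x| ^ Q * x (Fin.last m) ^ β) ∂(μH[(m:ℝ)]) ≤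
      ENNReal.ofReal (C1 * (k * C2)) * enD m α p u ^ (Q / p) := by
    have h := H1 (fun x => ENNReal.ofReal (|u x| ^ Q * x (Fin.last m) ^ β))
      ((hmu.pow_const _).mul (hmt.pow_const _)).ennreal_ofReal
      (ENNReal.ofReal k * ∫⁻ z in cubeQ (m+1), ENNReal.ofReal (trF m α Q b u z))
      ((top_int hα hQ1 hb1 hu).trans (by
        gcongr; linarith))
      (fun a => (lat_int hα hQ1 hβ hb a.2 (c := fun _ => 0) (fun y hy => ⟨le_rfl, Real.rpow_nonneg (hy.1 _).1 _⟩) hu).trans (by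
        gcongr; linarith))
      (fun a => (lat_int hα hQ1 hβ hb a.2 (c := fun y => y a.1.2 ^ α) (fun y hy => ⟨Real.rpow_nonneg (hy.1 _).1 _, le_rfl⟩) hu).trans (by
        gcongr; linarith))
    refine h.trans ?_
    rw [ENNReal.ofReal_mul hC1.le, ENNReal.ofReal_mul hk0.le, mul_assoc, mul_assoc]
    gcongr
    exact H2 u hu
  have hfr : ∀ x ∈ frontier S, 0 ≤ x (Fin.last m) ∧ x (Fin.last m) ≤ 1 := fun x hx =>
    ⟨(closure_S hα S hS (frontier_subset_closure hx)).1, (closure_S hα S hS (frontier_subset_closure hx)).2.1⟩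
  have hms : MeasurableSet (frontier S) := isClosed_frontier.measurableSet
  set f : EuclideanSpace ℝ (Fin (m+1)) → ℝ := fun x => |u x| * x (Fin.last m) ^ (β / Q) with hf
  have hfm : Measurable f := hmu.mul (hmt.pow_const _)
  have hpow : ∀ r : ℝ, 0 ≤ r → ∀ x ∈ frontier S, ‖f x‖ₑ ^ r = ENNReal.ofReal (|u x| ^ r * x (Fin.last m) ^ (β / Q * r)) := by
    intro r hr x hx
    have h0 := (hfr x hx).1
    have hf0 : 0 ≤ f x := by rw [hf]; positivity
    rw [Real.enorm_eq_ofReal hf0, ENNReal.ofReal_rpow_of_nonneg hf0 hr]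
    congr 1
    rw [hf]
    simp only
    rw [Real.mul_rpow (abs_nonneg _) (by positivity), ← Real.rpow_mul h0]
  have hHol := eLpNorm'_le_eLpNorm'_mul_rpow_measure_univ (μ := (μH[(m:ℝ)]).restrict (frontier S))
    (show 0 < q by linarith) hqQ hfm.aestronglyMeasurable
  unfold eLpNorm' at hHol
  rw [Measure.restrict_apply_univ, setLIntegral_congr_fun hms (hpow Q hQ0.le), div_mul_cancel₀ _ hQ0.ne',
    setLIntegral_congr_fun hms (hpow q (by linarith))] at hHol
  have hstep : (∫⁻ x in frontier S, ENNReal.ofReal (|u x| ^ q * x (Fin.last m) ^ β) ∂(μH[(m:ℝ)])) ^ (1/q) ≤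
      (∫⁻ x in frontier S, ENNReal.ofReal (|u x| ^ q * x (Fin.last m) ^ (β / Q * q)) ∂(μH[(m:ℝ)])) ^ (1/q) := by
    apply ENNReal.rpow_le_rpow _ (by positivity)
    apply setLIntegral_mono' hms
    intro x hx
    apply ENNReal.ofReal_le_ofReal
    gcongr ?_ * ?_
    apply Real.rpow_le_rpow_of_exponent_ge' (hfr x hx).1 (hfr x hx).2 (by positivity)
    rw [div_mul_eq_mul_div, div_le_iff₀ hQ0]
    gcongr
  refine hstep.trans (hHol.trans ?_)
  have hen : enD m α p u = (∫⁻ x in S, ENNReal.ofReal (‖fderiv ℝ u x‖ ^ p)) + ∫⁻ x in S, ENNReal.ofReal (|u x| ^ p) := by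
    rw [enD, cov_open hα S hS, cov_open hα S hS]
  calc _ ≤ (ENNReal.ofReal (C1 * (k * C2)) * enD m α p u ^ (Q / p)) ^ (1/Q) * ENNReal.ofReal C1 ^ e := by
        gcongr
    _ = ENNReal.ofReal ((C1 * (k * C2)) ^ (1/Q) * C1 ^ e) * enD m α p u ^ (1/p) := by
        rw [ENNReal.mul_rpow_of_nonneg _ _ (by positivity), ← ENNReal.rpow_mul,
          ENNReal.ofReal_rpow_of_pos (by positivity), ENNReal.ofReal_rpow_of_pos hC1,
          ENNReal.ofReal_mul (by positivity), show Q / p * (1 / Q) = 1 / p by field_simp]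
        ring
    _ ≤ _ := by
        gcongr
        rw [hen]
        exact ENNReal.rpow_add_le_add_rpow _ _ (by positivity) (by rw [div_le_one (by linarith)]; exact hp.le)

/-- Boundedness of the weighted Sobolev trace operator
`T : W^{1,p}(Ω_γ) → L^q(∂Ω_γ, w_γ)` with weight `w_γ(x) = x_n^β`,
`β = (γ-n)(1+p(n-2))/((n-p)(n-1))`, stated on C¹ functions. -/
theorem weighted_trace_embedding_bounded
    (n : ℕ) (hn : 2 ≤ n) (γ p q : ℝ)
    (hγ : (n : ℝ) < γ) (hp1 : 1 < p) (hpn : p < n)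
    (hq1 : 1 < q) (hq2 : q ≤ p * ((n : ℝ) - 1) / ((n : ℝ) - p)) :
    ∃ C : ℝ, 0 < C ∧
      ∀ u : EuclideanSpace ℝ (Fin n) → ℝ, ContDiff ℝ 1 u →
        (∫⁻ x in frontier (cuspDomain n hn γ),
            ENNReal.ofReal (|u x| ^ q *
              x ⟨n - 1, by omega⟩ ^
                ((γ - n) * (1 + p * ((n : ℝ) - 2)) / (((n : ℝ) - p) * ((n : ℝ) - 1))))
            ∂(μH[(n : ℝ) - 1])) ^ (1 / q)
        ≤ ENNReal.ofReal C *
          ((∫⁻ x in cuspDomain n hn γ, ENNReal.ofReal (‖fderiv ℝ u x‖ ^ p)) ^ (1 / p) +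
           (∫⁻ x in cuspDomain n hn γ, ENNReal.ofReal (|u x| ^ p)) ^ (1 / p)) := by
  obtain ⟨m, rfl⟩ : ∃ m, n = m + 1 := ⟨n - 1, by omega⟩
  have hm : 1 ≤ m := by omega
  have hm1 : (1:ℝ) ≤ m := by exact_mod_cast hm
  have hc : (((m + 1 : ℕ) : ℝ)) = (m:ℝ) + 1 := by push_cast; ring
  have hc1 : (((m + 1 : ℕ) : ℝ)) - 1 = (m:ℝ) := by push_cast; ring
  rw [hc] at hγ hpn
  rw [hc1, hc] at hq2
  have hnp : 0 < (m:ℝ) + 1 - p := by linarith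
  have hα : 1 ≤ (γ - 1) / (m:ℝ) := by
    rw [le_div_iff₀ (by linarith)]; linarith
  have hβ : 0 < (γ - ((m + 1 : ℕ) : ℝ)) * (1 + p * (((m + 1 : ℕ) : ℝ) - 2)) / ((((m + 1 : ℕ) : ℝ) - p) * (((m + 1 : ℕ) : ℝ) - 1)) := by
    rw [hc1, hc]
    have : 0 ≤ p * ((m:ℝ) + 1 - 2) := mul_nonneg (by linarith) (by linarith)
    have h2 : 0 < γ - ((m:ℝ) + 1) := by linarith
    positivity
  have hb : (m:ℝ) * ((γ - 1) / (m:ℝ) * m + 1 - p) / (m + 1 - p) =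
      (γ - ((m + 1 : ℕ) : ℝ)) * (1 + p * (((m + 1 : ℕ) : ℝ) - 2)) / ((((m + 1 : ℕ) : ℝ) - p) * (((m + 1 : ℕ) : ℝ) - 1))
        + (γ - 1) / (m:ℝ) * (m - 1) + 1 := by
    rw [hc1, hc]
    field_simp
    ring
  have h := trace_core hm hα hp1 hpn hq1 hq2 rfl hβ rfl hb (cuspDomain (m+1) hn γ) (by
    intro x
    unfold cuspDomain
    rw [hc1]
    constructor
    · rintro ⟨h1, h2, h3⟩
      exact ⟨h1, h2, fun i hi => h3 i (by
        have := Fin.lt_last_iff_ne_last.2 hi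
        simpa [Fin.lt_def] using this)⟩
    · rintro ⟨h1, h2, h3⟩
      refine ⟨h1, h2, fun i hi => h3 i ?_⟩
      rintro rfl
      simp at hi)
  rw [hc1] at h ⊢
  exact h
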